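/- Using the trial function u_γ(x) = e^{-|x|^γ/2}, one obtains the upper bound ∫_{ℝ²} Q(x)² dx ≤ 2πe ln 2, where Q is the unique positive radial solution of -ΔQ + Q - Q³ = 0 in ℝ². -/

import Mathlib

open MeasureTheory Real Filter

noncomputable section

abbrev E2 : Type := EuclideanSpace ℝ (Fin 2)

/-- squared norm of the gradient -/
def gradSq (u : E2 → ℝ) (x : E2) : ℝ := ‖fderiv ℝ u x‖ ^ 2

/-- the Laplacian as the sum of second partial derivatives -/
def lap (u : E2 → ℝ) (x : E2) : ℝ :=
  ∑ i : Fin 2, fderiv ℝ (fun y => fderiv ℝ u y (EuclideanSpace.single i 1)) x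
      (EuclideanSpace.single i 1)

/-- membership in H¹(ℝ²) together with L⁴ (which follows by Sobolev embedding) -/
def IsH1 (u : E2 → ℝ) : Prop :=
  Differentiable ℝ u ∧ Integrable (fun x => u x ^ 2) ∧
    Integrable (gradSq u) ∧ Integrable (fun x => u x ^ 4)

/-- `Q` is the (unique) positive radial H¹ solution of `-ΔQ + Q - Q³ = 0` in ℝ² -/
def IsGroundState (Q : E2 → ℝ) : Prop :=
  ContDiff ℝ 2 Q ∧ (∀ x, 0 < Q x) ∧ (∀ x y : E2, ‖x‖ = ‖y‖ → Q x = Q y) ∧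
    IsH1 Q ∧ ∀ x, -lap Q x + Q x - Q x ^ 3 = 0

/-- the space 𝓗 : H¹ functions with finite potential energy -/
def InH (V : E2 → ℝ) (u : E2 → ℝ) : Prop :=
  IsH1 u ∧ Integrable (fun x => V x * u x ^ 2)

/-- the Gross–Pitaevskii functional -/
def Ea (V : E2 → ℝ) (a : ℝ) (u : E2 → ℝ) : ℝ :=
  (∫ x, gradSq u x) + (∫ x, V x * u x ^ 2) - a / 2 * (∫ x, u x ^ 4)

/-- a minimizer of the GP functional on the unit L² sphere of 𝓗 -/
def IsMinimizer (V : E2 → ℝ) (a : ℝ) (u : E2 → ℝ) : Prop :=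
  InH V u ∧ (∫ x, u x ^ 2) = 1 ∧
    ∀ v, InH V v → (∫ x, v x ^ 2) = 1 → Ea V a u ≤ Ea V a v

/-- the GP ground-state energy, with values in ℝ ∪ {±∞} -/
def gpE (V : E2 → ℝ) (a : ℝ) : EReal :=
  sInf {y : EReal | ∃ u, InH V u ∧ (∫ x, u x ^ 2) = 1 ∧ y = (Ea V a u : EReal)}

section Aux
open Set Topology

def bI (r : ℝ) : ℝ := ∫ θ in (0:ℝ)..π, cosh (r * cos θ)
def bD (r : ℝ) : ℝ := ∫ θ in (0:ℝ)..π, sinh (r * cos θ) * cos θ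

lemma hasDerivAt_param (f f' : ℝ → ℝ → ℝ) (hf : Continuous (fun p : ℝ × ℝ => f p.1 p.2))
    (hf' : Continuous (fun p : ℝ × ℝ => f' p.1 p.2)) 
    (hd : ∀ r θ, HasDerivAt (fun x => f x θ) (f' r θ) r) (r : ℝ) :
    HasDerivAt (fun x => ∫ θ in (0:ℝ)..π, f x θ) (∫ θ in (0:ℝ)..π, f' r θ) r := by
  obtain ⟨C, hC⟩ := ((isCompact_closedBall r 1).prod (isCompact_uIcc (a := (0:ℝ)) (b := π))).exists_bound_of_continuousOn
    (f := fun p : ℝ × ℝ => f' p.1 p.2) hf'.continuousOn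
  refine (intervalIntegral.hasDerivAt_integral_of_dominated_loc_of_deriv_le (F := f) (F' := f') (x₀ := r)
    (s := Metric.ball r 1) (bound := fun _ => C)
    (Metric.ball_mem_nhds r one_pos) ?_ ?_ ?_ ?_ ?_ ?_).2
  · exact Eventually.of_forall fun x => (hf.comp (Continuous.prodMk_right x)).aestronglyMeasurable
  · exact (hf.comp (Continuous.prodMk_right r)).intervalIntegrable _ _
  · exact (hf'.comp (Continuous.prodMk_right r)).aestronglyMeasurable
  · exact Eventually.of_forall fun θ hθ x hx => hC (x, θ) ⟨Metric.ball_subset_closedBall hx, uIoc_subset_uIcc hθ⟩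
  · simp
  · exact Eventually.of_forall fun θ hθ x hx => hd x θ

lemma hasDerivAt_bI (r : ℝ) : HasDerivAt bI (bD r) r := by
  refine hasDerivAt_param (fun r θ => cosh (r * cos θ)) (fun r θ => sinh (r * cos θ) * cos θ)
    (by fun_prop) (by fun_prop) (fun r θ => ?_) r
  have := ((hasDerivAt_id' r).mul_const (cos θ)).cosh
  simpa using this

lemma hasDerivAt_bD_aux (r : ℝ) : HasDerivAt bD (∫ θ in (0:ℝ)..π, cosh (r * cos θ) * cos θ * cos θ) r := by
  refine hasDerivAt_param (fun r θ => sinh (r * cos θ) * cos θ) (fun r θ => cosh (r * cos θ) * cos θ * cos θ)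
    (by fun_prop) (by fun_prop) (fun r θ => ?_) r
  have := (((hasDerivAt_id' r).mul_const (cos θ)).sinh).mul_const (cos θ)
  simpa using this

lemma bD_eq (r : ℝ) : bD r = r * ∫ θ in (0:ℝ)..π, cosh (r * cos θ) * sin θ * sin θ := by
  have h : ∫ θ in (0:ℝ)..π, (cos θ * sinh (r * cos θ) - r * (cosh (r * cos θ) * sin θ * sin θ)) = 0 := by
    rw [intervalIntegral.integral_eq_sub_of_hasDerivAt (f := fun θ => sin θ * sinh (r * cos θ))]
    · simp
    · intro θ _
      have := (hasDerivAt_sin θ).mul (((hasDerivAt_cos θ).const_mul r).sinh)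
      refine this.congr_deriv ?_
      ring
    · exact Continuous.intervalIntegrable (by fun_prop) _ _
  rw [intervalIntegral.integral_sub (Continuous.intervalIntegrable (by fun_prop) _ _)
    (Continuous.intervalIntegrable (by fun_prop) _ _), intervalIntegral.integral_const_mul] at h
  have e : bD r = ∫ θ in (0:ℝ)..π, cos θ * sinh (r * cos θ) := by
    rw [bD]; congr 1; ext θ; ring
  linarith

lemma hasDerivAt_bD {r : ℝ} (hr : r ≠ 0) : HasDerivAt bD (bI r - bD r / r) r := by
  refine (hasDerivAt_bD_aux r).congr_deriv ?_
  rw [bD_eq, mul_div_cancel_left₀ _ hr, bI, ← intervalIntegral.integral_sub (Continuous.intervalIntegrable (by fun_prop) _ _)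
    (Continuous.intervalIntegrable (by fun_prop) _ _)]
  congr 1; ext θ
  linear_combination (cosh (r * cos θ)) * (Real.sin_sq_add_cos_sq θ)

lemma bI_pos (r : ℝ) : 0 < bI r := by
  refine intervalIntegral.intervalIntegral_pos_of_pos (Continuous.intervalIntegrable (by fun_prop) _ _)
    (fun θ => cosh_pos _) pi_pos

lemma bI_cont : Continuous bI := continuous_iff_continuousAt.2 fun r => (hasDerivAt_bI r).continuousAt
lemma bD_cont : Continuous bD := continuous_iff_continuousAt.2 fun r => (hasDerivAt_bD_aux r).continuousAt

lemma bD_nonneg {r : ℝ} (hr : 0 ≤ r) : 0 ≤ bD r := by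
  rw [bD_eq]
  refine mul_nonneg hr (intervalIntegral.integral_nonneg pi_pos.le fun θ _ => ?_)
  rw [mul_assoc]
  exact mul_nonneg (cosh_pos _).le (mul_self_nonneg _)

lemma bD_le (r : ℝ) : bD r ≤ bI r := by
  refine intervalIntegral.integral_mono_on pi_pos.le (Continuous.intervalIntegrable (by fun_prop) _ _)
    (Continuous.intervalIntegrable (by fun_prop) _ _) fun θ _ => ?_
  have h1 : |sinh (r * cos θ)| ≤ cosh (r * cos θ) := by
    rw [abs_le]; constructor
    · linarith [Real.cosh_add_sinh (r * cos θ), exp_pos (r * cos θ)]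
    · exact (Real.sinh_lt_cosh _).le
  calc _ ≤ |sinh (r * cos θ) * cos θ| := le_abs_self _
    _ = |sinh (r * cos θ)| * |cos θ| := abs_mul _ _
    _ ≤ cosh (r * cos θ) * 1 := mul_le_mul h1 (abs_cos_le_one θ) (abs_nonneg _) (cosh_pos _).le
    _ = _ := mul_one _

lemma bI_mono : MonotoneOn bI (Ici 0) := by
  refine monotoneOn_of_deriv_nonneg (convex_Ici 0) bI_cont.continuousOn
    (fun r _ => (hasDerivAt_bI r).differentiableAt.differentiableWithinAt) ?_
  intro r hr
  rw [interior_Ici] at hr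
  rw [(hasDerivAt_bI r).deriv]
  exact bD_nonneg (le_of_lt hr)

lemma bD_ge {r : ℝ} (hr : 2 ≤ r) : bI r / 2 ≤ bD r := by
  have hd : ∀ x, 0 < x → HasDerivAt (fun x => x * bD x - (x - 1) * bI x) ((x - 1) * (bI x - bD x)) x := by
    intro x hx
    have := ((hasDerivAt_id' x).mul (hasDerivAt_bD hx.ne')).sub (((hasDerivAt_id' x).sub_const 1).mul (hasDerivAt_bI x))
    refine this.congr_deriv ?_
    field_simp
    ring
  have hm : MonotoneOn (fun x => x * bD x - (x - 1) * bI x) (Ici 1) := by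
    refine monotoneOn_of_deriv_nonneg (convex_Ici 1)
      (fun x hx => (hd x (lt_of_lt_of_le one_pos hx)).continuousAt.continuousWithinAt)
      (fun x hx => ?_) ?_
    · rw [interior_Ici] at hx
      exact (hd x (lt_trans one_pos hx)).differentiableAt.differentiableWithinAt
    · intro x hx
      rw [interior_Ici] at hx
      rw [(hd x (lt_trans one_pos hx)).deriv]
      have hx' : 1 < x := hx
      exact mul_nonneg (by linarith) (by linarith [bD_le x])
  have h1 := hm (a := 1) (b := r) (by simp) (by simp; linarith) (by linarith)
  have h2 := bD_nonneg (r := 1) zero_le_one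
  simp at h1
  have h3 := bI_pos r
  by_contra! hc
  nlinarith

lemma bI_ratio {r t : ℝ} (hr : 0 ≤ r) (hrt : r ≤ t) : bI r ≤ exp 1 * exp (-((t - r) / 2)) * bI t := by
  have hm : MonotoneOn (fun x => bI x * exp (-(x / 2))) (Ici 2) := by
    have hd : ∀ x, HasDerivAt (fun x => bI x * exp (-(x / 2))) ((bD x - bI x / 2) * exp (-(x / 2))) x := by
      intro x
      have := (hasDerivAt_bI x).mul (((hasDerivAt_id' x).div_const 2).neg.exp)
      refine this.congr_deriv ?_
      simp; ring
    refine monotoneOn_of_deriv_nonneg (convex_Ici 2) 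
      (fun x hx => (hd x).continuousAt.continuousWithinAt)
      (fun x hx => (hd x).differentiableAt.differentiableWithinAt) ?_
    intro x hx
    rw [interior_Ici] at hx
    rw [(hd x).deriv]
    have := bD_ge (le_of_lt hx)
    exact mul_nonneg (by linarith) (exp_pos _).le
  have hIt := bI_pos t
  -- t <= 2
  have key : bI r * exp ((t - r) / 2) ≤ exp 1 * bI t := by
    rcases le_total t 2 with h | h
    · have h1 := bI_mono hr (hr.trans hrt) hrt
      have h2 : exp ((t - r) / 2) ≤ exp 1 := exp_le_exp.2 (by linarith)
      rw [mul_comm]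
      exact mul_le_mul h2 h1 (bI_pos r).le (exp_pos _).le
    · have h0 : bI (max r 2) * exp (-(max r 2 / 2)) ≤ bI t * exp (-(t / 2)) :=
        hm (mem_Ici.2 (le_max_right _ _)) h (max_le hrt h)
      have h1 : bI r ≤ bI (max r 2) := bI_mono hr (hr.trans (le_max_left _ _)) (le_max_left _ _)
      have h2 : bI r * exp (-(max r 2 / 2)) ≤ bI t * exp (-(t / 2)) :=
        le_trans (by gcongr) h0
      have h3 : bI r * exp ((t - max r 2) / 2) ≤ bI t := by
        have := mul_le_mul_of_nonneg_right h2 (exp_pos (t/2)).le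
        rw [mul_assoc, mul_assoc, ← exp_add, ← exp_add] at this
        rw [neg_add_cancel, exp_zero, mul_one] at this
        have e : (t - max r 2) / 2 = -(max r 2 / 2) + t / 2 := by ring
        rw [e]; exact this
      have h4 : exp ((t - r) / 2) ≤ exp 1 * exp ((t - max r 2) / 2) := by
        rw [← exp_add, exp_le_exp]
        have : max r 2 ≤ r + 2 := max_le (by linarith) (by linarith)
        linarith
      calc _ ≤ bI r * (exp 1 * exp ((t - max r 2) / 2)) := mul_le_mul_of_nonneg_left h4 (bI_pos r).le
        _ = exp 1 * (bI r * exp ((t - max r 2) / 2)) := by ring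
        _ ≤ _ := by gcongr
  rw [exp_neg]
  have : exp 1 * (exp ((t - r) / 2))⁻¹ * bI t = (exp 1 * bI t) / exp ((t - r) / 2) := by ring
  rw [this, le_div_iff₀ (exp_pos _)]
  exact key

abbrev muH : Measure ℝ := volume.restrict (Ioi (0:ℝ))
abbrev HH := Lp ℝ 2 muH

lemma cs_int {a b : ℝ → ℝ} (ha : MemLp a 2 muH) (hb : MemLp b 2 muH) :
    (∫ t, a t * b t ∂muH) ^ 2 ≤ (∫ t, a t ^ 2 ∂muH) * ∫ t, b t ^ 2 ∂muH := by
  have e : ∀ {x y : ℝ → ℝ} (hx : MemLp x 2 muH) (hy : MemLp y 2 muH),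
     inner ℝ (hx.toLp x) (hy.toLp y) = ∫ t, x t * y t ∂muH := by
    intro x y hx hy
    rw [L2.inner_def]
    refine integral_congr_ae ?_
    filter_upwards [hx.coeFn_toLp, hy.coeFn_toLp] with t h1 h2
    rw [h1, h2]; simp [mul_comm]
  have := real_inner_mul_inner_self_le (ha.toLp a) (hb.toLp b)
  rw [e, e, e] at this
  simpa only [sq] using this

def ph (r t : ℝ) : ℝ := if r < t then exp (-((t - r) / 2)) else 0

lemma ph_nonneg (r t : ℝ) : 0 ≤ ph r t := by unfold ph; split_ifs <;> positivity
lemma ph_le (r t : ℝ) : ph r t ≤ 1 := by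
  unfold ph; split_ifs with h
  · rw [exp_le_one_iff]; linarith
  · norm_num

lemma ph_meas : Measurable (fun p : ℝ × ℝ => ph p.1 p.2) := by
  unfold ph
  exact Measurable.ite (measurableSet_lt measurable_fst measurable_snd) (by fun_prop) measurable_const

lemma ph_int_t (r : ℝ) : Integrable (ph r) ∧ ∫ t, ph r t = 2 := by
  have e : ph r = indicator (Ioi r) (fun t => exp (r/2) * exp ((-1/2) * t)) := by
    ext t; simp only [ph, indicator, mem_Ioi, ← exp_add]; split_ifs <;> ring_nf
  rw [e]
  constructor
  · exact (integrable_indicator_iff measurableSet_Ioi).2 ((integrableOn_exp_mul_Ioi (by norm_num) r).const_mul _)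
  · rw [integral_indicator measurableSet_Ioi, integral_const_mul, integral_exp_mul_Ioi (by norm_num)]
    rw [neg_div, mul_neg, ← mul_div_assoc, ← exp_add]; ring_nf; norm_num

lemma ph_int_r (t : ℝ) : Integrable (fun r => ph r t) ∧ ∫ r, ph r t = 2 := by
  have e : (fun r => ph r t) = indicator (Iio t) (fun r => exp (-t/2) * exp ((1/2) * r)) := by
    ext r; simp only [ph, indicator, mem_Iio, ← exp_add]; split_ifs <;> ring_nf
  rw [e]
  constructor
  · exact (integrable_indicator_iff measurableSet_Iio).2 (((integrableOn_exp_mul_Iic (by norm_num) t).mono_set Iio_subset_Iic_self).const_mul _)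
  · rw [integral_indicator measurableSet_Iio, integral_const_mul, ← integral_Iic_eq_integral_Iio, integral_exp_mul_Iic (by norm_num)]
    rw [← mul_div_assoc, ← exp_add]; ring_nf; norm_num

lemma ph_int_t_le (r : ℝ) : ∫ t, ph r t ∂muH ≤ 2 := by
  rw [← (ph_int_t r).2]
  exact setIntegral_le_integral (ph_int_t r).1 (Eventually.of_forall fun t => ph_nonneg r t)

lemma ph_int_r_le (t : ℝ) : ∫ r, ph r t ∂muH ≤ 2 := by
  rw [← (ph_int_r t).2]
  exact setIntegral_le_integral (ph_int_r t).1 (Eventually.of_forall fun r => ph_nonneg r t)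

def kf (r t : ℝ) : ℝ := if r < t then bI r / (√t * bI t) else 0

lemma kf_meas : Measurable (fun p : ℝ × ℝ => kf p.1 p.2) := by
  unfold kf
  have := bI_cont.measurable
  exact Measurable.ite (measurableSet_lt measurable_fst measurable_snd) (by fun_prop) measurable_const

lemma kf_meas' (r : ℝ) : Measurable (kf r) := kf_meas.comp measurable_prodMk_left

lemma kf_nonneg (r t : ℝ) : 0 ≤ kf r t := by
  unfold kf; split_ifs
  · have := bI_pos r; have := bI_pos t; positivity
  · rfl

lemma kf_le {r t : ℝ} (hr : 0 < r) : kf r t ≤ exp 1 / √t * ph r t := by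
  unfold kf ph
  split_ifs with h
  · have ht : 0 < √t := sqrt_pos.2 (by linarith)
    have hb := bI_pos t
    have := bI_ratio hr.le h.le
    rw [div_le_iff₀ (by positivity)]
    calc bI r ≤ _ := this
      _ = _ := by field_simp
  · simp

lemma kf_sqrt_le {r t : ℝ} (hr : 0 < r) : √r * kf r t ≤ exp 1 * ph r t := by
  by_cases h : r < t
  · have ht : 0 < √t := sqrt_pos.2 (by linarith)
    have h1 : √r ≤ √t := sqrt_le_sqrt h.le
    have h2 := ph_nonneg r t
    calc _ ≤ √t * (exp 1 / √t * ph r t) := mul_le_mul h1 (kf_le hr) (kf_nonneg r t) ht.le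
      _ = _ := by field_simp
  · simp [kf, ph, h]

lemma kf_memLp {r : ℝ} (hr : 0 < r) : MemLp (kf r) 2 muH := by
  rw [memLp_two_iff_integrable_sq (kf_meas' r).aestronglyMeasurable]
  refine Integrable.mono' (((ph_int_t r).1.const_mul (exp 1 ^ 2 / r)).restrict) ((kf_meas' r).pow_const 2).aestronglyMeasurable
    (Eventually.of_forall fun t => ?_)
  rw [Real.norm_of_nonneg (by positivity), div_mul_eq_mul_div, le_div_iff₀ hr]
  have h1 := kf_sqrt_le (t := t) hr
  have h2 := kf_nonneg r t
  have h3 := ph_nonneg r t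
  have h4 := ph_le r t
  calc kf r t ^ 2 * r = (√r * kf r t) ^ 2 := by rw [mul_pow, sq_sqrt hr.le]; ring
    _ ≤ (exp 1 * ph r t) ^ 2 := by gcongr
    _ = exp 1 ^ 2 * (ph r t * ph r t) := by ring
    _ ≤ exp 1 ^ 2 * (ph r t * 1) := by gcongr
    _ = _ := by ring

def kL (r : ℝ) : HH := if h : 0 < r then (kf_memLp h).toLp (kf r) else 0

def UU (g : HH) (r : ℝ) : ℝ := inner ℝ (kL r) g

lemma kL_coe {r : ℝ} (hr : 0 < r) : kL r =ᵐ[muH] kf r := by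
  rw [kL, dif_pos hr]; exact MemLp.coeFn_toLp _

lemma UU_eq (g : HH) {r : ℝ} (hr : 0 < r) : UU g r = ∫ t, kf r t * g t ∂muH := by
  rw [UU, L2.inner_def]
  refine integral_congr_ae ?_
  filter_upwards [kL_coe hr] with t h1
  rw [h1]; simp [mul_comm]

lemma UU_integrable (g : HH) {r : ℝ} (hr : 0 < r) : Integrable (fun t => kf r t * g t) muH :=
  (kf_memLp hr).integrable_mul (Lp.memLp g)

lemma normsq_eq (g : HH) : ‖g‖ ^ 2 = ∫ t, g t ^ 2 ∂muH := by
  rw [← real_inner_self_eq_norm_sq, L2.inner_def]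
  congr 1; ext t; simp [sq]

lemma kL_normsq {r : ℝ} (hr : 0 < r) : ‖kL r‖ ^ 2 = ∫ t, kf r t ^ 2 ∂muH := by
  rw [normsq_eq]
  refine integral_congr_ae ?_
  filter_upwards [kL_coe hr] with t h1
  rw [h1]

lemma kf_sq_int {r : ℝ} (hr : 0 < r) : Integrable (fun t => kf r t ^ 2) muH := (kf_memLp hr).integrable_sq

lemma kL_bound1 {r : ℝ} (hr : 0 < r) : r * ‖kL r‖ ^ 2 ≤ 2 * exp 1 ^ 2 := by
  rw [kL_normsq hr, ← integral_const_mul]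
  calc ∫ t, r * kf r t ^ 2 ∂muH ≤ ∫ t, exp 1 ^ 2 * ph r t ∂muH := by
        refine integral_mono ((kf_sq_int hr).const_mul r) (((ph_int_t r).1.const_mul (exp 1 ^ 2)).restrict) fun t => ?_
        have h1 := kf_sqrt_le (t := t) hr
        have h2 := kf_nonneg r t
        have h3 := ph_nonneg r t
        have h4 := ph_le r t
        calc r * kf r t ^ 2 = (√r * kf r t) ^ 2 := by rw [mul_pow, sq_sqrt hr.le]
          _ ≤ (exp 1 * ph r t) ^ 2 := by gcongr
          _ = exp 1 ^ 2 * (ph r t * ph r t) := by ring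
          _ ≤ exp 1 ^ 2 * (ph r t * 1) := by gcongr
          _ = _ := by ring
    _ = exp 1 ^ 2 * ∫ t, ph r t ∂muH := integral_const_mul _ _
    _ ≤ exp 1 ^ 2 * 2 := by gcongr; exact ph_int_t_le r
    _ = _ := by ring

lemma kL_bound2 : ∃ C : ℝ, 0 ≤ C ∧ ∀ r, 0 < r → r * ‖kL r‖ ^ 4 ≤ C := by
  set B : ℝ := ∫ t in Ioi (0:ℝ), t ^ (-(1/2) : ℝ) * exp (-1 * t ^ (1:ℝ)) with hB
  have hBi : IntegrableOn (fun t : ℝ => t ^ (-(1/2) : ℝ) * exp (-1 * t ^ (1:ℝ))) (Ioi 0) :=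
    integrableOn_rpow_mul_exp_neg_mul_rpow (by norm_num) (by norm_num) (by norm_num)
  refine ⟨(exp 1 ^ 3 * B) ^ 2 + (2 * exp 1 ^ 2) ^ 2, by positivity, fun r hr => ?_⟩
  rcases le_total r 1 with h | h
  · have key : √r * ‖kL r‖ ^ 2 ≤ exp 1 ^ 3 * B := by
      rw [kL_normsq hr, ← integral_const_mul, hB, ← integral_const_mul]
      refine integral_mono_ae ((kf_sq_int hr).const_mul _) (hBi.const_mul _) ?_
      refine (ae_restrict_iff' measurableSet_Ioi).2 (Eventually.of_forall fun t ht => ?_)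
      have ht : 0 < t := ht
      have h2 := kf_nonneg r t
      have h3 := ph_nonneg r t
      simp only [rpow_one]
      have e1 : t ^ (-(1/2) : ℝ) = 1 / √t := by
        rw [Real.rpow_neg ht.le, ← Real.sqrt_eq_rpow, one_div]
      rw [e1]
      have hst : 0 < √t := sqrt_pos.2 ht
      have hp : ph r t ^ 2 ≤ exp 1 * exp (-1 * t) := by
        unfold ph; split_ifs
        · rw [← exp_nat_mul, ← exp_add, exp_le_exp]; push_cast; linarith
        · simp; positivity
      calc √r * kf r t ^ 2 = (√r * kf r t) * kf r t := by ring
        _ ≤ (exp 1 * ph r t) * (exp 1 / √t * ph r t) :=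
            mul_le_mul (kf_sqrt_le hr) (kf_le hr) h2 (by positivity)
        _ = exp 1 ^ 2 / √t * ph r t ^ 2 := by ring
        _ ≤ exp 1 ^ 2 / √t * (exp 1 * exp (-1 * t)) := by gcongr
        _ = _ := by ring
    calc r * ‖kL r‖ ^ 4 = (√r * ‖kL r‖ ^ 2) ^ 2 := by rw [mul_pow, sq_sqrt hr.le]; ring
      _ ≤ (exp 1 ^ 3 * B) ^ 2 := by gcongr
      _ ≤ _ := by nlinarith [sq_nonneg (2 * exp 1 ^ 2)]
  · have := kL_bound1 hr
    calc r * ‖kL r‖ ^ 4 ≤ r * (r * ‖kL r‖ ^ 4) := by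
          apply le_mul_of_one_le_left (by positivity) h
      _ = (r * ‖kL r‖ ^ 2) ^ 2 := by ring
      _ ≤ (2 * exp 1 ^ 2) ^ 2 := by gcongr
      _ ≤ _ := by nlinarith [sq_nonneg (exp 1 ^ 3 * B)]

lemma UU_abs_le (g : HH) (r : ℝ) : |UU g r| ≤ ‖kL r‖ * ‖g‖ := abs_real_inner_le_norm _ _

lemma UU_meas (g : HH) : AEStronglyMeasurable (UU g) muH := by
  have h1 : StronglyMeasurable (fun p : ℝ × ℝ => kf p.1 p.2 * g p.2) :=
    kf_meas.stronglyMeasurable.mul ((Lp.stronglyMeasurable g).comp_measurable measurable_snd)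
  have h2 := (h1.integral_prod_right' (ν := muH)).aestronglyMeasurable (μ := muH)
  refine h2.congr ?_
  refine (ae_restrict_iff' measurableSet_Ioi).2 (Eventually.of_forall fun r hr => ?_)
  exact (UU_eq g hr).symm

lemma hardy_pt (g : HH) {r : ℝ} (hr : 0 < r) :
    r * UU g r ^ 2 ≤ 2 * exp 1 ^ 2 * ∫ t, ph r t * g t ^ 2 ∂muH := by
  have hpm : Measurable (fun t => √(ph r t)) := (ph_meas.comp measurable_prodMk_left).sqrt
  have hg := Lp.memLp g
  have ha : MemLp (fun t => √(ph r t)) 2 muH := by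
    rw [memLp_two_iff_integrable_sq hpm.aestronglyMeasurable]
    refine ((ph_int_t r).1.restrict).congr (Eventually.of_forall fun t => ?_)
    simp only; rw [sq_sqrt (ph_nonneg r t)]
  have hb : MemLp (fun t => √(ph r t) * |g t|) 2 muH := by
    refine MemLp.of_le hg (hpm.aestronglyMeasurable.mul hg.1.norm) (Eventually.of_forall fun t => ?_)
    rw [norm_mul, Real.norm_of_nonneg (sqrt_nonneg _), norm_eq_abs, norm_eq_abs, abs_abs]
    exact mul_le_of_le_one_left (abs_nonneg _) (sqrt_le_one.2 (ph_le r t))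
  have h1 : |√r * UU g r| ≤ exp 1 * ∫ t, √(ph r t) * (√(ph r t) * |g t|) ∂muH := by
    rw [UU_eq g hr, ← integral_const_mul, ← integral_const_mul]
    refine (abs_integral_le_integral_abs).trans (integral_mono_of_nonneg (Eventually.of_forall fun t => abs_nonneg _)
      ((ha.integrable_mul hb).const_mul _) (Eventually.of_forall fun t => ?_))
    simp only
    rw [← mul_assoc √(ph r t), mul_self_sqrt (ph_nonneg r t), ← mul_assoc, abs_mul, ← mul_assoc, 
      abs_of_nonneg (mul_nonneg (sqrt_nonneg r) (kf_nonneg r t))]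
    exact mul_le_mul_of_nonneg_right (kf_sqrt_le hr) (abs_nonneg _)
  have h2 := cs_int ha hb
  have e1 : ∫ t, √(ph r t) ^ 2 ∂muH = ∫ t, ph r t ∂muH := by
    congr 1; ext t; rw [sq_sqrt (ph_nonneg r t)]
  have e2 : ∫ t, (√(ph r t) * |g t|) ^ 2 ∂muH = ∫ t, ph r t * g t ^ 2 ∂muH := by
    congr 1; ext t; rw [mul_pow, sq_sqrt (ph_nonneg r t), sq_abs]
  rw [e1, e2] at h2
  have h3 := ph_int_t_le r
  have h4 : 0 ≤ ∫ t, ph r t * g t ^ 2 ∂muH := integral_nonneg fun t => mul_nonneg (ph_nonneg r t) (sq_nonneg _)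
  calc r * UU g r ^ 2 = |√r * UU g r| ^ 2 := by rw [sq_abs, mul_pow, sq_sqrt hr.le]
    _ ≤ (exp 1 * ∫ t, √(ph r t) * (√(ph r t) * |g t|) ∂muH) ^ 2 := by gcongr
    _ = exp 1 ^ 2 * (∫ t, √(ph r t) * (√(ph r t) * |g t|) ∂muH) ^ 2 := by ring
    _ ≤ exp 1 ^ 2 * ((∫ t, ph r t ∂muH) * ∫ t, ph r t * g t ^ 2 ∂muH) := by gcongr
    _ ≤ exp 1 ^ 2 * (2 * ∫ t, ph r t * g t ^ 2 ∂muH) := by gcongr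
    _ = _ := by ring

lemma hardy (g : HH) : Integrable (fun r => r * UU g r ^ 2) muH ∧
    ∫ r, r * UU g r ^ 2 ∂muH ≤ 4 * exp 1 ^ 2 * ‖g‖ ^ 2 := by
  have hg2 : Integrable (fun t => g t ^ 2) muH := (Lp.memLp g).integrable_sq
  have hprod : Integrable (fun p : ℝ × ℝ => ph p.1 p.2 * g p.2 ^ 2) (muH.prod muH) := by
    have hm : StronglyMeasurable (fun p : ℝ × ℝ => ph p.1 p.2 * g p.2 ^ 2) :=
      ph_meas.stronglyMeasurable.mul (((Lp.stronglyMeasurable g).comp_measurable measurable_snd).pow 2)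
    rw [integrable_prod_iff' hm.aestronglyMeasurable]
    refine ⟨Eventually.of_forall fun t => ((ph_int_r t).1.restrict (s := Ioi 0)).mul_const (g t ^ 2), ?_⟩
    refine Integrable.mono' (hg2.const_mul 2) ?_ (Eventually.of_forall fun t => ?_)
    · exact (hm.norm.integral_prod_left' (μ := muH)).aestronglyMeasurable
    · rw [Real.norm_of_nonneg (integral_nonneg fun _ => norm_nonneg _)]
      have : ∀ r, ‖ph r t * g t ^ 2‖ = ph r t * g t ^ 2 := fun r =>
        Real.norm_of_nonneg (mul_nonneg (ph_nonneg r t) (sq_nonneg _))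
      simp only [this]
      rw [integral_mul_const]
      exact mul_le_mul_of_nonneg_right (ph_int_r_le t) (sq_nonneg _)
  have hI := hprod.integral_prod_left
  have hpt : ∀ᵐ r ∂muH, r * UU g r ^ 2 ≤ 2 * exp 1 ^ 2 * ∫ t, ph r t * g t ^ 2 ∂muH :=
    (ae_restrict_iff' measurableSet_Ioi).2 (Eventually.of_forall fun r hr => hardy_pt g hr)
  have hinteg : Integrable (fun r => r * UU g r ^ 2) muH := by
    refine Integrable.mono' (hI.const_mul (2 * exp 1 ^ 2)) (measurable_id.aestronglyMeasurable.mul ((UU_meas g).pow 2)) ?_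
    filter_upwards [hpt, ae_restrict_mem measurableSet_Ioi] with r h1 h2
    have h2 : 0 < r := h2
    rw [Real.norm_of_nonneg (by positivity)]
    exact h1
  refine ⟨hinteg, ?_⟩
  calc _ ≤ ∫ r, 2 * exp 1 ^ 2 * ∫ t, ph r t * g t ^ 2 ∂muH ∂muH :=
        integral_mono_ae hinteg (hI.const_mul _) hpt
    _ = 2 * exp 1 ^ 2 * ∫ t, ∫ r, ph r t * g t ^ 2 ∂muH ∂muH := by
        rw [integral_const_mul, integral_integral_swap hprod]
    _ ≤ 2 * exp 1 ^ 2 * ∫ t, 2 * g t ^ 2 ∂muH := by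
        refine mul_le_mul_of_nonneg_left ?_ (by positivity)
        refine integral_mono hprod.integral_prod_right (hg2.const_mul 2) fun t => ?_
        simp only
        rw [integral_mul_const]
        exact mul_le_mul_of_nonneg_right (ph_int_r_le t) (sq_nonneg _)
    _ = _ := by rw [integral_const_mul, normsq_eq]; ring

instance fact2t : Fact ((2:ENNReal) ≠ ⊤) := ⟨by norm_num⟩

lemma weak_seq (g : ℕ → HH) (hg : ∀ n, ‖g n‖ ≤ 1) : ∃ g0 : HH, ‖g0‖ ≤ 1 ∧ ∃ φ : ℕ → ℕ, StrictMono φ ∧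
    ∀ h : HH, Tendsto (fun n => inner ℝ h (g (φ n))) atTop (𝓝 (inner ℝ h g0)) := by
  have hc := WeakDual.isSeqCompact_closedBall ℝ HH 0 1
  let x : ℕ → WeakDual ℝ HH := fun n => StrongDual.toWeakDual (InnerProductSpace.toDual ℝ HH (g n))
  have hx : ∀ n, x n ∈ WeakDual.toStrongDual ⁻¹' Metric.closedBall (0 : StrongDual ℝ HH) 1 := by
    intro n
    rw [mem_preimage, mem_closedBall_zero_iff]
    show ‖InnerProductSpace.toDual ℝ HH (g n)‖ ≤ 1
    rw [LinearIsometryEquiv.norm_map]; exact hg n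
  obtain ⟨a, ha, φ, hφ, hlim⟩ := hc hx
  refine ⟨(InnerProductSpace.toDual ℝ HH).symm (WeakDual.toStrongDual a), ?_, φ, hφ, fun h => ?_⟩
  · rw [LinearIsometryEquiv.norm_map]
    rwa [mem_preimage, mem_closedBall_zero_iff] at ha
  · have := ((WeakDual.eval_continuous h).tendsto a).comp hlim
    have e : (inner ℝ h ((InnerProductSpace.toDual ℝ HH).symm (WeakDual.toStrongDual a)) : ℝ) = a h := by
      rw [real_inner_comm, InnerProductSpace.toDual_symm_apply]; rfl
    rw [e]
    refine this.congr fun n => ?_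
    show (InnerProductSpace.toDual ℝ HH (g (φ n))) h = _
    rw [InnerProductSpace.toDual_apply_apply, real_inner_comm]

def FF (g : HH) : ℝ := ∫ r, r * UU g r ^ 4 ∂muH

lemma U2_bound (g : HH) {r : ℝ} (hr : 0 < r) : r * UU g r ^ 2 ≤ 2 * exp 1 ^ 2 * ‖g‖ ^ 2 := by
  have h := kL_bound1 hr
  have h2 := UU_abs_le g r
  calc r * UU g r ^ 2 = r * |UU g r| ^ 2 := by rw [sq_abs]
    _ ≤ r * (‖kL r‖ * ‖g‖) ^ 2 := by gcongr
    _ = (r * ‖kL r‖ ^ 2) * ‖g‖ ^ 2 := by ring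
    _ ≤ _ := by gcongr

lemma U4_bound : ∃ C : ℝ, 0 ≤ C ∧ ∀ (g : HH) (r : ℝ), 0 < r → r * UU g r ^ 4 ≤ C * ‖g‖ ^ 4 := by
  obtain ⟨C, hC, h⟩ := kL_bound2
  refine ⟨C, hC, fun g r hr => ?_⟩
  have h2 := UU_abs_le g r
  calc r * UU g r ^ 4 = r * |UU g r| ^ 4 := by rw [Even.pow_abs ⟨2, rfl⟩]
    _ ≤ r * (‖kL r‖ * ‖g‖) ^ 4 := by gcongr
    _ = (r * ‖kL r‖ ^ 4) * ‖g‖ ^ 4 := by ring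
    _ ≤ _ := by gcongr; exact h r hr

lemma U4_meas (g : HH) : AEStronglyMeasurable (fun r => r * UU g r ^ 4) muH :=
  measurable_id.aestronglyMeasurable.mul ((UU_meas g).pow 4)

lemma U4_int (g : HH) : Integrable (fun r => r * UU g r ^ 4) muH := by
  obtain ⟨C, hC, h⟩ := U4_bound
  have h1 : Integrable (indicator (Ioc (0:ℝ) 1) (fun _ => C * ‖g‖ ^ 4)) muH := by
    refine Integrable.restrict ?_
    rw [integrable_indicator_iff measurableSet_Ioc]
    exact integrableOn_const (by simp)
  refine Integrable.mono' (h1.add ((hardy g).1.const_mul (2 * exp 1 ^ 2 * ‖g‖ ^ 2))) (U4_meas g) ?_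
  filter_upwards [ae_restrict_mem measurableSet_Ioi] with r hr
  have hr : 0 < r := hr
  rw [Real.norm_of_nonneg (by positivity)]
  simp only [Pi.add_apply, indicator, mem_Ioc]
  split_ifs with h2
  · have := h g r hr
    have : 0 ≤ 2 * exp 1 ^ 2 * ‖g‖ ^ 2 * (r * UU g r ^ 2) := by positivity
    linarith [h g r hr]
  · have h3 : 1 < r := by by_contra hh; exact h2 ⟨hr, by linarith⟩
    have h4 := U2_bound g hr
    have h5 : UU g r ^ 2 ≤ r * UU g r ^ 2 := le_mul_of_one_le_left (by positivity) h3.le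
    rw [zero_add]
    calc r * UU g r ^ 4 = UU g r ^ 2 * (r * UU g r ^ 2) := by ring
      _ ≤ _ := by gcongr; linarith

lemma FF_nonneg (g : HH) : 0 ≤ FF g := by
  refine integral_nonneg_of_ae ?_
  filter_upwards [ae_restrict_mem measurableSet_Ioi] with r hr
  have hr : 0 < r := hr
  simp only [Pi.zero_apply]; positivity

lemma FF_split (g : HH) {A : ℝ} (hA : 0 < A) :
    FF g = (∫ r in Ioc 0 A, r * UU g r ^ 4) + ∫ r in Ioi A, r * UU g r ^ 4 := by
  have hi := U4_int g
  unfold FF muH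
  rw [← Ioc_union_Ioi_eq_Ioi hA.le]
  exact setIntegral_union (Ioc_disjoint_Ioi le_rfl) measurableSet_Ioi (IntegrableOn.mono_set hi Ioc_subset_Ioi_self)
    (IntegrableOn.mono_set hi (Ioi_subset_Ioi hA.le))

lemma FF_tail (g : HH) {A : ℝ} (hA : 0 < A) :
    ∫ r in Ioi A, r * UU g r ^ 4 ≤ 8 * exp 1 ^ 4 * ‖g‖ ^ 4 / A := by
  have hi : IntegrableOn (fun r => r * UU g r ^ 4) (Ioi A) := IntegrableOn.mono_set (U4_int g) (Ioi_subset_Ioi hA.le)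
  have hh := hardy g
  have hj : IntegrableOn (fun r => r * UU g r ^ 2) (Ioi A) := IntegrableOn.mono_set hh.1 (Ioi_subset_Ioi hA.le)
  calc _ ≤ ∫ r in Ioi A, (2 * exp 1 ^ 2 * ‖g‖ ^ 2 / A) * (r * UU g r ^ 2) := by
        refine setIntegral_mono_on hi (hj.const_mul _) measurableSet_Ioi fun r hr => ?_
        have hr : A < r := hr
        have hr0 : 0 < r := hA.trans hr
        have h4 := U2_bound g hr0
        have h5 : UU g r ^ 2 ≤ 2 * exp 1 ^ 2 * ‖g‖ ^ 2 / A := by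
          rw [le_div_iff₀ hA]
          nlinarith [sq_nonneg (UU g r)]
        calc r * UU g r ^ 4 = UU g r ^ 2 * (r * UU g r ^ 2) := by ring
          _ ≤ _ := by gcongr
    _ = (2 * exp 1 ^ 2 * ‖g‖ ^ 2 / A) * ∫ r in Ioi A, r * UU g r ^ 2 := integral_const_mul _ _
    _ ≤ (2 * exp 1 ^ 2 * ‖g‖ ^ 2 / A) * (4 * exp 1 ^ 2 * ‖g‖ ^ 2) := by
        refine mul_le_mul_of_nonneg_left (le_trans ?_ hh.2) (by positivity)
        refine setIntegral_mono_set hh.1 ?_ (Ioi_subset_Ioi hA.le).eventuallyLE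
        filter_upwards [ae_restrict_mem measurableSet_Ioi] with r hr
        have hr : 0 < r := hr
        simp only [Pi.zero_apply]; positivity
    _ = _ := by ring

lemma UU_smul (c : ℝ) (g : HH) (r : ℝ) : UU (c • g) r = c * UU g r := by
  simp [UU, inner_smul_right]
lemma UU_add (f g : HH) (r : ℝ) : UU (f + g) r = UU f r + UU g r := by
  simp [UU, inner_add_right]

lemma FF_smul (c : ℝ) (g : HH) : FF (c • g) = c ^ 4 * FF g := by
  unfold FF
  rw [← integral_const_mul]; congr 1; ext r; rw [UU_smul]; ring

lemma FF_abs (g : HH) : FF g ≤ FF |g| := by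
  refine integral_mono_ae (U4_int g) (U4_int _) ?_
  filter_upwards [ae_restrict_mem measurableSet_Ioi] with r hr
  have hr : 0 < r := hr
  have : |UU g r| ≤ UU |g| r := by
    rw [UU_eq _ hr, UU_eq _ hr]
    refine abs_integral_le_integral_abs.trans (le_of_eq (integral_congr_ae ?_))
    filter_upwards [Lp.coeFn_abs g] with t ht
    rw [ht, abs_mul, abs_of_nonneg (kf_nonneg r t)]
  have h4 : UU g r ^ 4 ≤ UU |g| r ^ 4 := by
    rw [← Even.pow_abs ⟨2, rfl⟩]; gcongr
  gcongr

theorem exists_max (h0 : HH) (hF : 0 < FF h0) : ∃ (S : ℝ) (g : HH), 0 < S ∧ ‖g‖ = 1 ∧ FF g = S ∧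
    (∀ᵐ t ∂muH, 0 ≤ g t) ∧ ∀ h, FF h ≤ S * ‖h‖ ^ 4 := by
  obtain ⟨C, hC, hCb⟩ := U4_bound
  set B : Set ℝ := FF '' Metric.closedBall 0 1 with hB
  have hne : B.Nonempty := ⟨FF 0, 0, by simp, rfl⟩
  have hbound : ∀ g : HH, ‖g‖ ≤ 1 → FF g ≤ C + 8 * exp 1 ^ 4 := by
    intro g hg
    have hg4 : ‖g‖ ^ 4 ≤ 1 := pow_le_one₀ (norm_nonneg _) hg
    rw [FF_split g one_pos]
    refine add_le_add ?_ ?_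
    · have : ∫ r in Ioc 0 1, r * UU g r ^ 4 ≤ ∫ r in Ioc (0:ℝ) 1, C := by
        refine setIntegral_mono_on (IntegrableOn.mono_set (U4_int g) Ioc_subset_Ioi_self) (integrableOn_const (by simp)) measurableSet_Ioc
          fun r hr => ?_
        have := hCb g r hr.1
        nlinarith
      simpa using this
    · refine (FF_tail g one_pos).trans ?_
      rw [div_one]
      nlinarith [exp_pos 1, pow_pos (exp_pos 1) 4]
  have hbdd : BddAbove B := by
    refine ⟨C + 8 * exp 1 ^ 4, ?_⟩
    rintro _ ⟨g, hg, rfl⟩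
    exact hbound g (by simpa using hg)
  obtain ⟨x, -, hxl, hxm⟩ := exists_seq_tendsto_sSup hne hbdd
  set S := sSup B with hS
  have hsup : ∀ h : HH, FF h ≤ S * ‖h‖ ^ 4 := by
    intro h
    by_cases hh : ‖h‖ = 0
    · rw [norm_eq_zero] at hh
      subst hh
      have := FF_smul 0 (0:HH)
      rw [zero_smul] at this
      rw [this]; simp
    · have hp : 0 < ‖h‖ := lt_of_le_of_ne (norm_nonneg _) (Ne.symm hh)
      have h1 : FF (‖h‖⁻¹ • h) ≤ S := by
        refine le_csSup hbdd ⟨_, ?_, rfl⟩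
        rw [mem_closedBall_zero_iff, norm_smul, norm_inv, norm_norm, inv_mul_cancel₀ hh]
      rw [FF_smul, inv_pow, inv_mul_le_iff₀ (by positivity)] at h1
      linarith
  have hSpos : 0 < S := by
    by_contra hneg
    have h1 := hsup h0
    have : S * ‖h0‖ ^ 4 ≤ 0 := mul_nonpos_of_nonpos_of_nonneg (by linarith) (by positivity)
    linarith
  choose g hg hgx using hxm
  have hg1 : ∀ n, ‖g n‖ ≤ 1 := fun n => by simpa using hg n
  obtain ⟨g0, hg0, φ, hφ, hlim⟩ := weak_seq g hg1
  have hge : S ≤ FF g0 := by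
    have key : ∀ A : ℝ, 0 < A → S ≤ FF g0 + 8 * exp 1 ^ 4 / A := by
      intro A hA
      have t1 : Tendsto (fun n => FF (g (φ n))) atTop (𝓝 S) := by
        have := hxl.comp hφ.tendsto_atTop
        refine this.congr fun n => ?_
        simp [hgx]
      have t2 : Tendsto (fun n => ∫ r in Ioc 0 A, r * UU (g (φ n)) r ^ 4) atTop (𝓝 (∫ r in Ioc 0 A, r * UU g0 r ^ 4)) := by
        refine tendsto_integral_of_dominated_convergence (fun _ => C) ?_ ?_ ?_ ?_
        · intro n
          exact (U4_meas _).mono_measure (Measure.restrict_mono Ioc_subset_Ioi_self le_rfl)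
        · exact integrableOn_const (by simp)
        · intro n
          filter_upwards [ae_restrict_mem measurableSet_Ioc] with r hr
          have hr0 := hr.1
          rw [Real.norm_of_nonneg (by positivity)]
          have hg4 : ‖g (φ n)‖ ^ 4 ≤ 1 := pow_le_one₀ (norm_nonneg _) (hg1 _)
          have := hCb (g (φ n)) r hr.1
          nlinarith
        · exact Eventually.of_forall fun r => ((hlim (kL r)).pow 4).const_mul r
      refine le_of_tendsto_of_tendsto t1 ((t2.add_const (8 * exp 1 ^ 4 / A))) ?_ |>.trans ?_
      · refine Eventually.of_forall fun n => ?_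
        simp only
        rw [FF_split _ hA]
        have hg4 : ‖g (φ n)‖ ^ 4 ≤ 1 := pow_le_one₀ (norm_nonneg _) (hg1 _)
        have h2 := FF_tail (g (φ n)) hA
        have h3 : 8 * exp 1 ^ 4 * ‖g (φ n)‖ ^ 4 / A ≤ 8 * exp 1 ^ 4 / A := 
          div_le_div_of_nonneg_right (mul_le_of_le_one_right (by positivity) hg4) hA.le
        linarith
      · rw [FF_split g0 hA]
        have : 0 ≤ ∫ r in Ioi A, r * UU g0 r ^ 4 := by
          refine setIntegral_nonneg measurableSet_Ioi fun r hr => ?_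
          have hr : A < r := hr
          have : 0 < r := hA.trans hr
          positivity
        linarith
    refine le_of_forall_pos_le_add fun ε hε => ?_
    have := key (8 * exp 1 ^ 4 / ε) (by positivity)
    rwa [div_div_cancel₀ (by positivity)] at this
  have hn : ‖g0‖ = 1 := by
    refine le_antisymm hg0 ?_
    by_contra hlt
    push Not at hlt
    have h1 := hsup g0
    have h2 : ‖g0‖ ^ 4 < 1 := pow_lt_one₀ (norm_nonneg _) hlt (by norm_num)
    nlinarith
  have hn' : ‖|g0|‖ = 1 := by rw [norm_abs_eq_norm, hn]
  refine ⟨S, |g0|, hSpos, hn', ?_, ?_, hsup⟩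
  · refine le_antisymm ?_ (hge.trans (FF_abs g0))
    have := hsup |g0|
    rwa [hn', one_pow, mul_one] at this
  · filter_upwards [Lp.coeFn_abs g0] with t ht
    rw [ht]; exact abs_nonneg _

lemma U31_int (g h : HH) : Integrable (fun r => r * UU g r ^ 3 * UU h r) muH := by
  refine Integrable.mono' ((U4_int g).add (U4_int h)) ((measurable_id.aestronglyMeasurable.mul ((UU_meas g).pow 3)).mul (UU_meas h)) ?_
  filter_upwards [ae_restrict_mem measurableSet_Ioi] with r hr
  have hr : 0 < r := hr
  simp only [Pi.add_apply]
  rw [norm_eq_abs, mul_assoc, abs_mul, abs_of_pos hr, ← mul_add]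
  refine mul_le_mul_of_nonneg_left ?_ hr.le
  set x := UU g r
  set y := UU h r
  rw [abs_le]
  constructor <;>
    nlinarith [sq_nonneg (x ^ 2 - y ^ 2), sq_nonneg (x ^ 2 + x * y), sq_nonneg (x ^ 2 - x * y), sq_nonneg (x*y), sq_nonneg (x^2), sq_nonneg (y^2)]

theorem euler_lagrange {S : ℝ} {g : HH} (hn : ‖g‖ = 1) (hS : FF g = S)
    (hsup : ∀ h, FF h ≤ S * ‖h‖ ^ 4) (h : HH) :
    ∫ r, r * UU g r ^ 3 * UU h r ∂muH = S * inner ℝ g h := by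
  set L := ∫ r, r * UU g r ^ 3 * UU h r ∂muH with hL
  set a : ℝ := inner ℝ g h
  set b := ‖h‖ ^ 2
  let f : ℝ → ℝ := fun ε => S * (1 + 2 * ε * a + ε ^ 2 * b) ^ 2 - S - 4 * ε * L
  have hf : ∀ ε, 0 ≤ f ε := by
    intro ε
    have h1 := hsup (g + ε • h)
    have h2 : ‖g + ε • h‖ ^ 2 = 1 + 2 * ε * a + ε ^ 2 * b := by
      rw [norm_add_sq_real, hn, inner_smul_right, norm_smul, mul_pow, norm_eq_abs, sq_abs]; ring
    have h3 : ‖g + ε • h‖ ^ 4 = (1 + 2 * ε * a + ε ^ 2 * b) ^ 2 := by rw [← h2]; ring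
    rw [h3] at h1
    have h4 : S + 4 * ε * L ≤ FF (g + ε • h) := by
      have e : S + 4 * ε * L = ∫ r, (r * UU g r ^ 4 + 4 * ε * (r * UU g r ^ 3 * UU h r)) ∂muH := by
        rw [integral_add (U4_int g) ((U31_int g h).const_mul _), integral_const_mul, ← hS]; rfl
      rw [e]
      refine integral_mono_ae ((U4_int g).add ((U31_int g h).const_mul _)) (U4_int _) ?_
      filter_upwards [ae_restrict_mem measurableSet_Ioi] with r hr
      have hr : 0 < r := hr
      simp only [UU_add, UU_smul]
      set x := UU g r
      set y := ε * UU h r with hy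
      have : x ^ 4 + 4 * x ^ 3 * y ≤ (x + y) ^ 4 := by
        nlinarith [sq_nonneg (y * (2 * x + y)), sq_nonneg (x * y), sq_nonneg (y * (x + y))]
      calc r * x ^ 4 + 4 * ε * (r * x ^ 3 * UU h r) = r * (x ^ 4 + 4 * x ^ 3 * y) := by rw [hy]; ring
        _ ≤ _ := by gcongr
    simp only [f]
    linarith
  have hd : HasDerivAt f (4 * S * a - 4 * L) 0 := by
    have hid := hasDerivAt_id (0:ℝ)
    have h1 : HasDerivAt (fun ε : ℝ => 1 + 2 * ε * a + ε ^ 2 * b) (2 * a) 0 := by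
      have := (((hid.const_mul 2).mul_const a).const_add 1).add ((hid.pow 2).mul_const b)
      refine this.congr_deriv ?_
      simp
    have := (((h1.pow 2).const_mul S).sub_const S).sub ((hid.const_mul 4).mul_const L)
    refine this.congr_deriv ?_
    simp; ring
  have hmin : IsLocalMin f 0 := by
    refine Eventually.of_forall fun ε => ?_
    have : f 0 = 0 := by simp [f]
    rw [this]; exact hf ε
  have := hmin.hasDerivAt_eq_zero hd
  linarith

/-- the kernel -/
def kt (r : ℝ) : ℝ := ∫ t in Ioi r, 1 / (t * bI t ^ 2)

lemma inner_kL {r s : ℝ} (hr : 0 < r) (hs : 0 < s) :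
    inner ℝ (kL r) (kL s) = bI r * bI s * kt (max r s) := by
  rw [L2.inner_def, kt, ← integral_const_mul]
  have e : ∀ t, (indicator (Ioi (max r s)) (fun t => bI r * bI s * (1 / (t * bI t ^ 2))) t) = kf r t * kf s t := by
    intro t
    simp only [indicator, mem_Ioi, max_lt_iff, kf]
    by_cases h1 : r < t <;> by_cases h2 : s < t <;> simp [h1, h2]
    have ht : 0 < t := hr.trans h1
    have hb := bI_pos t
    field_simp
    rw [sq_sqrt ht.le]
  rw [← integral_indicator (s := Ioi (max r s)) measurableSet_Ioi, integral_congr_ae (Eventually.of_forall e)]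
  rw [← setIntegral_eq_integral_of_forall_compl_eq_zero (s := Ioi 0) (f := fun t => kf r t * kf s t)]
  · refine integral_congr_ae ?_
    filter_upwards [kL_coe hr, kL_coe hs] with t h1 h2
    rw [h1, h2]; simp [mul_comm]
  · intro t ht
    have : ¬ r < t := fun h => ht (hr.trans h)
    simp [kf, this]

structure RadSol (u u1 : ℝ → ℝ) (α : ℝ) : Prop where
  pos : ∀ r, 0 < r → 0 < u r
  d : ∀ r, 0 < r → HasDerivAt u (u1 r) r
  d1 : ∀ r, 0 < r → HasDerivAt u1 (-(u1 r) / r + u r - u r ^ 3) r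
  apos : 0 < α
  lim : Tendsto u (𝓝[>] 0) (𝓝 α)
  lim1 : Tendsto u1 (𝓝[>] 0) (𝓝 0)
  int : IntegrableOn (fun r => r * (u r ^ 2 + u1 r ^ 2 + u r ^ 4)) (Ioi 0)

lemma freq_small (e : ℝ → ℝ) (_he : ∀ r, 0 < r → 0 ≤ e r)
    (hi : IntegrableOn (fun r => r * e r) (Ioi 0)) (ε A : ℝ) (hε : 0 < ε) :
    ∃ r, A < r ∧ 1 < r ∧ r ^ 2 * e r < ε := by
  by_contra! hcon
  have h1 : IntegrableOn (fun r : ℝ => r⁻¹) (Ioi (max A 1)) := by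
    have h2 : IntegrableOn (fun r => ε⁻¹ * (r * e r)) (Ioi (max A 1)) :=
      (hi.mono_set (Ioi_subset_Ioi (le_trans zero_le_one (le_max_right _ _)))).const_mul _
    refine Integrable.mono' h2 (measurable_inv.aestronglyMeasurable) ?_
    refine (ae_restrict_iff' measurableSet_Ioi).2 (Eventually.of_forall fun r hr => ?_)
    have hA : A < r := lt_of_le_of_lt (le_max_left _ _) hr
    have h1 : 1 < r := lt_of_le_of_lt (le_max_right _ _) hr
    have := hcon r hA h1
    have hr0 : 0 < r := by linarith
    rw [norm_inv, Real.norm_of_nonneg hr0.le, inv_mul_eq_div, le_div_iff₀ hε, inv_mul_le_iff₀ hr0]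
    nlinarith
  exact not_integrableOn_Ioi_inv h1

lemma neg_of_deriv (f f' : ℝ → ℝ) (b : ℝ) (hb : 0 < b) (hf : ∀ r, 0 < r → HasDerivAt f (f' r) r)
    (hneg : ∀ r, 0 < r → r < b → f' r < 0) (hl : Tendsto f (𝓝[>] 0) (𝓝 0)) : f b < 0 := by
  have hanti : StrictAntiOn f (Ioc 0 b) := by
    refine strictAntiOn_of_deriv_neg (convex_Ioc 0 b) 
      (fun r hr => (hf r hr.1).continuousAt.continuousWithinAt) ?_
    intro r hr
    rw [interior_Ioc] at hr
    rw [(hf r hr.1).deriv]; exact hneg r hr.1 hr.2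
  have h1 : f (b/2) ≤ 0 := by
    refine ge_of_tendsto hl ?_
    have : Ioo (0:ℝ) (b/2) ∈ 𝓝[>] (0:ℝ) := Ioo_mem_nhdsGT (by linarith)
    filter_upwards [this] with r hr
    exact (hanti ⟨hr.1, by linarith [hr.2]⟩ ⟨by linarith, by linarith⟩ hr.2).le
  have := hanti (a := b/2) (b := b) ⟨by linarith, by linarith⟩ ⟨hb, le_rfl⟩ (by linarith)
  linarith

def PP (u u1 : ℝ → ℝ) (r : ℝ) : ℝ :=
  r ^ 2 * u1 r ^ 2 / 2 + r * u r * u1 r / 3 + u r ^ 2 / 9 - r ^ 2 * u r ^ 2 / 2 + r ^ 2 * u r ^ 4 / 4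

def JJ (u u1 : ℝ → ℝ) (r : ℝ) : ℝ := r ^ (-(2/3) : ℝ) * PP u u1 r

lemma hasDerivAt_rho {r : ℝ} (hr : 0 < r) :
    HasDerivAt (fun r : ℝ => r ^ (-(2/3) : ℝ)) (-(2/3) * r ^ (-(2/3) : ℝ) / r) r := by
  have := Real.hasDerivAt_rpow_const (x := r) (p := (-(2/3) : ℝ)) (Or.inl hr.ne')
  convert this using 1
  rw [Real.rpow_sub hr, Real.rpow_one]; ring

lemma RadSol.hasDerivAt_JJ {u u1 : ℝ → ℝ} {α : ℝ} (h : RadSol u u1 α) {r : ℝ} (hr : 0 < r) :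
    HasDerivAt (JJ u u1) (-(r ^ (-(2/3) : ℝ) * (r / 3 + 2 / 27 / r) * u r ^ 2)) r := by
  have hu := h.d r hr
  have hu1 := h.d1 r hr
  have hid := hasDerivAt_id' r
  have hP := (((((((hid.pow 2).mul (hu1.pow 2)).div_const 2).add
    (((hid.mul hu).mul hu1).div_const 3)).add ((hu.pow 2).div_const 9)).sub
    (((hid.pow 2).mul (hu.pow 2)).div_const 2)).add (((hid.pow 2).mul (hu.pow 4)).div_const 4))
  have := (hasDerivAt_rho hr).mul hP
  refine this.congr_deriv ?_
  simp
  field_simp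
  ring

lemma RadSol.JJ_bound {u u1 : ℝ → ℝ} {r : ℝ} (hr : 1 < r) :
    |JJ u u1 r| ≤ 2 * (r ^ 2 * (u r ^ 2 + u1 r ^ 2 + u r ^ 4)) := by
  have h0 : 0 < r ^ (-(2/3) : ℝ) := by positivity
  have h1 : r ^ (-(2/3) : ℝ) ≤ 1 := Real.rpow_le_one_of_one_le_of_nonpos hr.le (by norm_num)
  have hP : |PP u u1 r| ≤ 2 * (r ^ 2 * (u r ^ 2 + u1 r ^ 2 + u r ^ 4)) := by
    have ha : r ≤ r^2 := by nlinarith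
    have hb : 1 ≤ r^2 := by nlinarith
    have e1 : |r * u r * u1 r| ≤ r^2 * (u r ^2 + u1 r^2) := by
      rw [mul_assoc, abs_mul, abs_of_pos (by linarith : 0 < r)]
      have : |u r * u1 r| ≤ u r ^2 + u1 r^2 := by
        rw [abs_le]; constructor <;> nlinarith [sq_nonneg (u r + u1 r), sq_nonneg (u r - u1 r), sq_nonneg (u r), sq_nonneg (u1 r)]
      exact mul_le_mul ha this (abs_nonneg _) (by positivity)
    have e2 : u r ^ 2 ≤ r^2 * u r^2 := by nlinarith [sq_nonneg (u r)]
    have e3 : 0 ≤ r^2 * u r^2 := by positivity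
    have e4 : 0 ≤ r^2 * u1 r^2 := by positivity
    have e5 : 0 ≤ r^2 * u r^4 := by positivity
    have e6 : 0 ≤ u r^2 := by positivity
    obtain ⟨e7, e8⟩ := abs_le.1 e1
    unfold PP
    rw [abs_le]; constructor <;> nlinarith
  rw [JJ, abs_mul, abs_of_pos h0]
  calc _ ≤ 1 * |PP u u1 r| := by gcongr
    _ ≤ _ := by rw [one_mul]; exact hP

lemma RadSol.JJ_pos {u u1 : ℝ → ℝ} {α : ℝ} (h : RadSol u u1 α) {r : ℝ} (hr : 0 < r) :
    0 < JJ u u1 r := by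
  have hanti : StrictAntiOn (JJ u u1) (Ioi 0) := by
    refine strictAntiOn_of_deriv_neg (convex_Ioi 0)
      (fun r hr => (h.hasDerivAt_JJ hr).continuousAt.continuousWithinAt) ?_
    intro r hr
    rw [interior_Ioi] at hr
    have hr' : 0 < r := hr
    rw [(h.hasDerivAt_JJ hr).deriv]
    have := h.pos r hr
    have : 0 < r ^ (-(2/3) : ℝ) * (r / 3 + 2 / 27 / r) * u r ^ 2 := by positivity
    linarith
  by_contra! hcon
  have h1 : JJ u u1 (r+1) < 0 := lt_of_lt_of_le (hanti hr (by simp; linarith) (by linarith)) hcon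
  obtain ⟨s, hs1, hs2, hs3⟩ := freq_small _ (fun r hr => by positivity) h.int
    (-(JJ u u1 (r+1))/2) (r+1) (by linarith)
  have h2 := hanti (a := r+1) (b := s) (by simp; linarith) (by simp; linarith) hs1
  have h3 := RadSol.JJ_bound (u := u) (u1 := u1) hs2
  have := (abs_le.1 h3).1
  linarith

lemma RadSol.no_lt {u u1 v v1 : ℝ → ℝ} {α β : ℝ} (hu : RadSol u u1 α) (hv : RadSol v v1 β)
    (hlt : α < β) : False := by
  set Wr : ℝ → ℝ := fun r => r * (v1 r * u r - v r * u1 r) with hWr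
  have hWd : ∀ r, 0 < r → HasDerivAt Wr (r * u r * v r * (u r ^ 2 - v r ^ 2)) r := by
    intro r hr
    have := (hasDerivAt_id' r).mul (((hv.d1 r hr).mul (hu.d r hr)).sub ((hv.d r hr).mul (hu.d1 r hr)))
    refine this.congr_deriv ?_
    simp
    field_simp
    ring
  have hid0 : Tendsto (fun r : ℝ => r) (𝓝[>] 0) (𝓝 0) := tendsto_nhdsWithin_of_tendsto_nhds tendsto_id
  have hWl : Tendsto Wr (𝓝[>] 0) (𝓝 0) := by
    have := hid0.mul ((hv.lim1.mul hu.lim).sub (hv.lim.mul hu.lim1))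
    simpa using this
  set w : ℝ → ℝ := fun r => v r / u r with hw
  have hwd : ∀ r, 0 < r → HasDerivAt w (Wr r / (r * u r ^ 2)) r := by
    intro r hr
    have h0 := (hu.pos r hr).ne'
    have := (hv.d r hr).div (hu.d r hr) h0
    refine this.congr_deriv ?_
    simp only [hWr]
    field_simp
  set X : ℝ → ℝ := fun r => w r ^ 2 * JJ u u1 r - JJ v v1 r with hX
  have hXd : ∀ r, 0 < r → HasDerivAt X (2 * w r * (Wr r / (r * u r ^ 2)) * JJ u u1 r) r := by
    intro r hr
    have h0 := (hu.pos r hr).ne'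
    have := (((hwd r hr).pow 2).mul (hu.hasDerivAt_JJ hr)).sub (hv.hasDerivAt_JJ hr)
    refine this.congr_deriv ?_
    have e : v r = w r * u r := by simp only [hw]; field_simp
    rw [e]
    simp
    ring
  have hwpos : ∀ r, 0 < r → 0 < w r := fun r hr => div_pos (hv.pos r hr) (hu.pos r hr)
  have hXsign : ∀ r, 0 < r → Wr r < 0 → 2 * w r * (Wr r / (r * u r ^ 2)) * JJ u u1 r < 0 := by
    intro r hr h
    have h1 := hu.pos r hr
    have h2 := hwpos r hr
    have h3 := hu.JJ_pos hr
    have : Wr r / (r * u r ^ 2) < 0 := div_neg_of_neg_of_pos h (by positivity)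
    have h4 : 0 < 2 * w r * JJ u u1 r := by positivity
    nlinarith
  have hwl : Tendsto w (𝓝[>] 0) (𝓝 (β / α)) := hv.lim.div hu.lim hu.apos.ne'
  have hXl : Tendsto X (𝓝[>] 0) (𝓝 0) := by
    have hc : Tendsto (fun r : ℝ => r ^ (1/3 : ℝ)) (𝓝[>] 0) (𝓝 0) := by
      have : ContinuousAt (fun r : ℝ => r ^ (1/3 : ℝ)) 0 :=
        Real.continuousAt_rpow_const _ _ (Or.inr (by norm_num))
      have h := this.tendsto
      rw [Real.zero_rpow (by norm_num)] at h
      exact tendsto_nhdsWithin_of_tendsto_nhds h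
    have hm : Tendsto (fun r : ℝ => r ^ (1/3 : ℝ) * (r * (w r ^ 2 * u1 r ^ 2 - v1 r ^ 2) / 2 +
       (w r ^ 2 * (u r * u1 r) - v r * v1 r) / 3 + r * (w r ^ 2 * u r ^ 4 - v r ^ 4) / 4)) (𝓝[>] 0) (𝓝 0) := by
      have := hc.mul ((((hid0.mul (((hwl.pow 2).mul (hu.lim1.pow 2)).sub (hv.lim1.pow 2))).div_const 2).add
        ((((hwl.pow 2).mul (hu.lim.mul hu.lim1)).sub (hv.lim.mul hv.lim1)).div_const 3)).add
        ((hid0.mul (((hwl.pow 2).mul (hu.lim.pow 4)).sub (hv.lim.pow 4))).div_const 4))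
      simpa using this
    refine hm.congr' ?_
    filter_upwards [self_mem_nhdsWithin] with r hr
    have hr' : 0 < r := hr
    have e : v r = w r * u r := by simp only [hw]; field_simp [(hu.pos r hr).ne']
    have e2 : r ^ (1/3 : ℝ) = r ^ (-(2/3) : ℝ) * r := by
      conv_rhs => rw [← Real.rpow_add_one hr'.ne']
      norm_num
    simp only [hX, JJ, PP]
    rw [e, e2]
    ring
  -- Wr < 0 everywhere
  have hWneg : ∀ r, 0 < r → Wr r < 0 := by
    have hgap : ∀ b, 0 < b → (∀ r, 0 < r → r < b → u r < v r) → Wr b < 0 := by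
      intro b hb h
      refine neg_of_deriv Wr _ b hb hWd (fun r hr hrb => ?_) hWl
      have h1 := hu.pos r hr
      have h2 := hv.pos r hr
      have h3 := h r hr hrb
      have : u r ^ 2 - v r ^ 2 < 0 := by nlinarith
      exact mul_neg_of_pos_of_neg (by positivity) this
    obtain ⟨δ, hδ, hδ2⟩ : ∃ δ > 0, ∀ r, 0 < r → r < δ → u r < v r := by
      have := hu.lim.eventually_lt hv.lim hlt
      obtain ⟨δ, hδ, h⟩ := mem_nhdsGT_iff_exists_Ioo_subset.1 this
      exact ⟨δ, hδ, fun r h1 h2 => h ⟨h1, h2⟩⟩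
    have hnear : ∀ r, 0 < r → r < δ → Wr r < 0 := fun r h1 h2 =>
      hgap r h1 (fun s hs1 hs2 => hδ2 s hs1 (by linarith))
    by_contra! hcon
    obtain ⟨b, hb, hWb⟩ := hcon
    have hbδ : δ ≤ b := by
      by_contra! h
      linarith [hnear b hb h]
    have hcont : ContinuousOn Wr (Icc δ b) := fun r hr =>
      (hWd r (by linarith [hr.1])).continuousAt.continuousWithinAt
    have hcl : IsCompact (Icc δ b ∩ Wr ⁻¹' (Ici 0)) :=
      isCompact_Icc.of_isClosed_subset (hcont.preimage_isClosed_of_isClosed isClosed_Icc isClosed_Ici)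
        inter_subset_left
    obtain ⟨r0, ⟨⟨h1, h2⟩, h3⟩, h4⟩ := hcl.exists_isLeast ⟨b, ⟨hbδ, le_rfl⟩, hWb⟩
    have h3' : 0 ≤ Wr r0 := h3
    have hr0 : 0 < r0 := by linarith
    have hlt0 : ∀ r, 0 < r → r < r0 → Wr r < 0 := by
      intro r hr hrr
      by_cases hc : r < δ
      · exact hnear r hr hc
      · by_contra! hc2
        have := h4 ⟨⟨not_lt.1 hc, by linarith⟩, hc2⟩
        linarith
    have hW0 : Wr r0 = 0 := by
      refine le_antisymm ?_ h3'
      have ht : Tendsto Wr (𝓝[<] r0) (𝓝 (Wr r0)) :=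
        tendsto_nhdsWithin_of_tendsto_nhds (hWd r0 hr0).continuousAt.tendsto
      refine le_of_tendsto ht ?_
      filter_upwards [Ioo_mem_nhdsLT hr0] with r hr
      exact (hlt0 r hr.1 hr.2).le
    have hXneg := neg_of_deriv X _ r0 hr0 hXd (fun r a b => hXsign r a (hlt0 r a b)) hXl
    have hanti : AntitoneOn w (Ioc 0 r0) := by
      refine antitoneOn_of_deriv_nonpos (convex_Ioc 0 r0)
        (fun r hr => (hwd r hr.1).continuousAt.continuousWithinAt)
        (fun r hr => by rw [interior_Ioc] at hr; exact (hwd r hr.1).differentiableAt.differentiableWithinAt) ?_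
      intro r hr
      rw [interior_Ioc] at hr
      rw [(hwd r hr.1).deriv]
      have := hu.pos r hr.1
      have h0 := hr.1
      exact div_nonpos_of_nonpos_of_nonneg (hlt0 r hr.1 hr.2).le (by positivity)
    have hwgt : 1 < w r0 := by
      have hu0 := hu.pos r0 hr0
      have e : v r0 = w r0 * u r0 := by simp only [hw]; field_simp
      have e1 : v1 r0 = w r0 * u1 r0 := by
        simp only [hWr] at hW0
        have : v1 r0 * u r0 - v r0 * u1 r0 = 0 := by
          rcases mul_eq_zero.1 hW0 with h | h
          · linarith
          · exact h
        simp only [hw]; field_simp; linarith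
      have hXe : X r0 = r0 ^ (-(2/3) : ℝ) * (r0 ^ 2 * u r0 ^ 4 / 4) * (w r0 ^ 2 * (1 - w r0 ^ 2)) := by
        simp only [hX, JJ, PP]
        rw [e, e1]; ring
      rw [hXe] at hXneg
      have hp : 0 < r0 ^ (-(2/3) : ℝ) * (r0 ^ 2 * u r0 ^ 4 / 4) := by positivity
      have := hwpos r0 hr0
      by_contra! hc
      have : 0 ≤ w r0 ^ 2 * (1 - w r0 ^ 2) := mul_nonneg (by positivity) (by nlinarith)
      nlinarith [mul_nonneg hp.le this]
    have := hgap r0 hr0 (fun r a b => by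
      have h1 : w r0 ≤ w r := hanti ⟨a, b.le⟩ ⟨hr0, le_rfl⟩ b.le
      have h2 : 1 < v r / u r := lt_of_lt_of_le hwgt h1
      rwa [one_lt_div (hu.pos r a)] at h2)
    linarith
  have hX1 := neg_of_deriv X _ 1 one_pos hXd (fun r a _ => hXsign r a (hWneg r a)) hXl
  have hXanti : AntitoneOn X (Ioi 0) := by
    refine antitoneOn_of_deriv_nonpos (convex_Ioi 0)
      (fun r hr => (hXd r hr).continuousAt.continuousWithinAt)
      (fun r hr => by rw [interior_Ioi] at hr; exact (hXd r hr).differentiableAt.differentiableWithinAt) ?_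
    intro r hr
    rw [interior_Ioi] at hr
    rw [(hXd r hr).deriv]
    exact (hXsign r hr (hWneg r hr)).le
  have hwanti : AntitoneOn w (Ioi 0) := by
    refine antitoneOn_of_deriv_nonpos (convex_Ioi 0)
      (fun r hr => (hwd r hr).continuousAt.continuousWithinAt)
      (fun r hr => by rw [interior_Ioi] at hr; exact (hwd r hr).differentiableAt.differentiableWithinAt) ?_
    intro r hr
    rw [interior_Ioi] at hr
    have hr' : 0 < r := hr
    rw [(hwd r hr).deriv]
    have := hu.pos r hr
    exact div_nonpos_of_nonpos_of_nonneg (hWneg r hr).le (by positivity)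
  have hinteg := hu.int.add hv.int
  obtain ⟨s, hs1, hs2, hs3⟩ := freq_small
    (fun r => (u r ^ 2 + u1 r ^ 2 + u r ^ 4) + (v r ^ 2 + v1 r ^ 2 + v r ^ 4))
    (fun r hr => by positivity) (by
      refine hinteg.congr (Eventually.of_forall fun r => ?_)
      simp only [Pi.add_apply]; ring)
    (- X 1 / (2 * (w 1 ^ 2 + 1))) 1 (div_pos (by linarith) (by positivity))
  have hs0 : 0 < s := by linarith
  rw [lt_div_iff₀ (by positivity)] at hs3
  have h1 : X s ≤ X 1 := hXanti (by simp) hs0 hs1.le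
  have h2 : w s ≤ w 1 := hwanti (by simp) hs0 hs1.le
  have h3 : w s ^ 2 ≤ w 1 ^ 2 := by have := hwpos s hs0; gcongr
  have b1 := RadSol.JJ_bound (u := v) (u1 := v1) hs2
  have b2 := (abs_le.1 b1).2
  have p1 := hu.JJ_pos hs0
  set A := s ^ 2 * (u s ^ 2 + u1 s ^ 2 + u s ^ 4)
  set B := s ^ 2 * (v s ^ 2 + v1 s ^ 2 + v s ^ 4) with hB
  have hA : 0 ≤ s ^ 2 * (u s ^ 2 + u1 s ^ 2 + u s ^ 4) := by positivity
  have hBB : 0 ≤ B := by positivity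
  have hXs : X s = w s ^ 2 * JJ u u1 s - JJ v v1 s := rfl
  have h5 : 0 ≤ w s ^ 2 * JJ u u1 s := by positivity
  have h6 : s ^ 2 * ((u s ^ 2 + u1 s ^ 2 + u s ^ 4) + (v s ^ 2 + v1 s ^ 2 + v s ^ 4)) = 
     s ^ 2 * (u s ^ 2 + u1 s ^ 2 + u s ^ 4) + B := by rw [hB]; ring
  rw [h6] at hs3
  nlinarith [mul_nonneg hA (sq_nonneg (w 1)), mul_nonneg hBB (sq_nonneg (w 1))]

lemma bdd_near {u : ℝ → ℝ} {α : ℝ} (hc : ∀ r, 0 < r → ContinuousAt u r)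
    (hl : Tendsto u (𝓝[>] 0) (𝓝 α)) (R : ℝ) : ∃ C, 0 ≤ C ∧ ∀ r, 0 < r → r ≤ R → |u r| ≤ C := by
  have h1 : ∀ᶠ r in 𝓝[>] (0:ℝ), |u r| < |α| + 1 :=
    hl.abs.eventually_lt_const (by linarith)
  obtain ⟨δ, hδ, h⟩ := mem_nhdsGT_iff_exists_Ioo_subset.1 h1
  have hδ' : 0 < δ := hδ
  obtain ⟨C, hC⟩ := (isCompact_Icc (a := δ) (b := R)).exists_bound_of_continuousOn
    (f := u) (fun r hr => (hc r (by linarith [hr.1])).continuousWithinAt)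
  refine ⟨max (|α| + 1) C, le_trans (by positivity) (le_max_left _ _), fun r h0 hR => ?_⟩
  by_cases hr : r < δ
  · exact le_trans (h ⟨h0, hr⟩ : |u r| < |α| + 1).le (le_max_left _ _)
  · exact le_trans (hC r ⟨not_lt.1 hr, hR⟩) (le_max_right _ _)

lemma RadSol.eq_of_eq {u u1 v v1 : ℝ → ℝ} {α : ℝ} (hu : RadSol u u1 α) (hv : RadSol v v1 α)
    {R : ℝ} (hR : 0 < R) : u R = v R := by
  obtain ⟨A, hA0, hA⟩ := bdd_near (fun r hr => (hu.d r hr).continuousAt) hu.lim R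
  obtain ⟨B, hB0, hB⟩ := bdd_near (fun r hr => (hv.d r hr).continuousAt) hv.lim R
  set C : ℝ := 3 + (A + B) ^ 2 with hC
  set D : ℝ → ℝ := fun r => (u1 r - v1 r) ^ 2 + (u r - v r) ^ 2 with hD
  have hd : ∀ r, 0 < r → HasDerivAt (fun r => D r * exp (-(2 * C * r)))
     ((2 * (u1 r - v1 r) * ((-(u1 r) / r + u r - u r ^ 3) - (-(v1 r) / r + v r - v r ^ 3))
       + 2 * (u r - v r) * (u1 r - v1 r) - 2 * C * D r) * exp (-(2 * C * r))) r := by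
    intro r hr
    have e := (((hasDerivAt_id' r).const_mul (2 * C)).neg).exp
    have := ((((hu.d1 r hr).sub (hv.d1 r hr)).pow 2).add (((hu.d r hr).sub (hv.d r hr)).pow 2)).mul e
    refine this.congr_deriv ?_
    simp [hD]
    ring
  have hanti : AntitoneOn (fun r => D r * exp (-(2 * C * r))) (Ioc 0 R) := by
    refine antitoneOn_of_deriv_nonpos (convex_Ioc 0 R)
      (fun r hr => (hd r hr.1).continuousAt.continuousWithinAt)
      (fun r hr => by rw [interior_Ioc] at hr; exact (hd r hr.1).differentiableAt.differentiableWithinAt) ?_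
    intro r hr
    rw [interior_Ioc] at hr
    have hr0 := hr.1
    rw [(hd r hr.1).deriv]
    refine mul_nonpos_of_nonpos_of_nonneg ?_ (exp_pos _).le
    obtain ⟨a1, a2⟩ := abs_le.1 (hA r hr.1 hr.2.le)
    obtain ⟨b1, b2⟩ := abs_le.1 (hB r hr.1 hr.2.le)
    set x := u r
    set y := v r
    set p := u1 r
    set q := v1 r
    have hk : |x ^ 2 + x * y + y ^ 2| ≤ (A + B) ^ 2 := by
      rw [abs_le]; constructor <;> nlinarith
    have hx : x ^ 3 - y ^ 3 = (x - y) * (x ^ 2 + x * y + y ^ 2) := by ring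
    set k := x ^ 2 + x * y + y ^ 2
    have : 2 * (p - q) * ((-p / r + x - x ^ 3) - (-q / r + y - y ^ 3)) + 2 * (x - y) * (p - q) - 2 * C * D r
       = - (2 / r * (p - q) ^ 2) + 2 * (2 - k) * ((p - q) * (x - y)) - 2 * C * ((p-q)^2 + (x-y)^2) := by
      have : D r = (p-q)^2 + (x-y)^2 := rfl
      rw [this]
      field_simp
      linear_combination (-2 * (p - q) * r) * hx
    rw [this]
    have t1 : 0 ≤ 2 / r * (p - q) ^ 2 := by positivity
    have t2 : |(2 - k)| ≤ C := by
      obtain ⟨k1, k2⟩ := abs_le.1 hk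
      rw [abs_le]; constructor <;> linarith
    have t3 : |(p - q) * (x - y)| ≤ (p-q)^2 + (x-y)^2 := by
      rw [abs_le]; constructor <;> nlinarith [sq_nonneg (p-q+(x-y)), sq_nonneg (p-q-(x-y)), sq_nonneg (p-q), sq_nonneg (x-y)]
    have t4 : (2 - k) * ((p - q) * (x - y)) ≤ C * ((p-q)^2 + (x-y)^2) := by
      calc _ ≤ |(2 - k) * ((p - q) * (x - y))| := le_abs_self _
        _ = |2 - k| * |(p - q) * (x - y)| := abs_mul _ _
        _ ≤ _ := by gcongr
    linarith
  have hl : Tendsto (fun r => D r * exp (-(2 * C * r))) (𝓝[>] 0) (𝓝 0) := by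
    have e : Tendsto (fun r : ℝ => exp (-(2 * C * r))) (𝓝[>] 0) (𝓝 (exp (-(2*C*0)))) :=
      tendsto_nhdsWithin_of_tendsto_nhds (Continuous.tendsto (by fun_prop) 0)
    have := (((hu.lim1.sub hv.lim1).pow 2).add ((hu.lim.sub hv.lim).pow 2)).mul e
    simpa using this
  have h0 : D R * exp (-(2 * C * R)) ≤ 0 := by
    refine ge_of_tendsto hl ?_
    filter_upwards [Ioo_mem_nhdsGT hR] with r hr
    exact hanti ⟨hr.1, hr.2.le⟩ ⟨hR, le_rfl⟩ hr.2.le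
  have h1 : D R ≤ 0 := by
    by_contra! h
    linarith [mul_pos h (exp_pos (-(2 * C * R)))]
  have : (u R - v R) ^ 2 = 0 := by
    have : D R = (u1 R - v1 R) ^ 2 + (u R - v R) ^ 2 := rfl
    nlinarith [sq_nonneg (u1 R - v1 R), sq_nonneg (u R - v R)]
  have := pow_eq_zero_iff (two_ne_zero) |>.1 this
  linarith

theorem RadSol.unique {u u1 v v1 : ℝ → ℝ} {α β : ℝ} (hu : RadSol u u1 α) (hv : RadSol v v1 β)
    {R : ℝ} (hR : 0 < R) : u R = v R := by
  rcases lt_trichotomy α β with h | h | h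
  · exact (hu.no_lt hv h).elim
  · subst h; exact hu.eq_of_eq hv hR
  · exact (hv.no_lt hu h).elim

theorem RadSol.pohozaev {u u1 : ℝ → ℝ} {α : ℝ} (h : RadSol u u1 α) 
    (h2 : IntegrableOn (fun r => r * u r ^ 2) (Ioi 0)) (h4 : IntegrableOn (fun r => r * u r ^ 4) (Ioi 0)) :
    ∫ r in Ioi (0:ℝ), r * u r ^ 2 = (∫ r in Ioi (0:ℝ), r * u r ^ 4) / 2 := by
  set E : ℝ → ℝ := fun r => r ^ 2 * u1 r ^ 2 / 2 - r ^ 2 * u r ^ 2 / 2 + r ^ 2 * u r ^ 4 / 4 with hE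
  have hd : ∀ r ∈ Ioi (0:ℝ), HasDerivAt E (r * u r ^ 4 / 2 - r * u r ^ 2) r := by
    intro r hr
    have hr' : 0 < r := hr
    have hid := hasDerivAt_id' r
    have hu := h.d r hr
    have hu1 := h.d1 r hr
    have := ((((hid.pow 2).mul (hu1.pow 2)).div_const 2).sub
     (((hid.pow 2).mul (hu.pow 2)).div_const 2)).add (((hid.pow 2).mul (hu.pow 4)).div_const 4)
    refine this.congr_deriv ?_
    simp
    field_simp
    ring
  have hi : IntegrableOn (fun r => r * u r ^ 4 / 2 - r * u r ^ 2) (Ioi 0) := (h4.div_const 2).sub h2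
  have hid0 : Tendsto (fun r : ℝ => r) (𝓝[>] 0) (𝓝 0) := tendsto_nhdsWithin_of_tendsto_nhds tendsto_id
  have hl0 : Tendsto E (𝓝[>] 0) (𝓝 0) := by
    have := ((((hid0.pow 2).mul (h.lim1.pow 2)).div_const 2).sub
     (((hid0.pow 2).mul (h.lim.pow 2)).div_const 2)).add (((hid0.pow 2).mul (h.lim.pow 4)).div_const 4)
    simpa using this
  have hinf : Tendsto E atTop (𝓝 (limUnder atTop E)) :=
    tendsto_limUnder_of_hasDerivAt_of_integrableOn_Ioi hd hi
  have hz : limUnder atTop E = 0 := by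
    by_contra hne
    have hpos : 0 < |limUnder atTop E| := abs_pos.2 hne
    have := hinf.abs.eventually_const_lt (show |limUnder atTop E| / 2 < _ by linarith)
    obtain ⟨A, hA⟩ := eventually_atTop.1 this
    obtain ⟨s, hs1, hs2, hs3⟩ := freq_small _ (fun r hr => by positivity) h.int
      (|limUnder atTop E| / 2) A (by linarith)
    have h1 := hA s hs1.le
    have h2 : |E s| ≤ s ^ 2 * (u s ^ 2 + u1 s ^ 2 + u s ^ 4) := by
      have e3 : 0 ≤ s^2 * u s^2 := by positivity
      have e4 : 0 ≤ s^2 * u1 s^2 := by positivity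
      have e5 : 0 ≤ s^2 * u s^4 := by positivity
      simp only [hE]
      rw [abs_le]; constructor <;> nlinarith
    linarith
  rw [hz] at hinf
  have hE0 : E 0 = 0 := by simp [hE]
  have hcont : ContinuousWithinAt E (Ici 0) 0 := by
    rw [← continuousWithinAt_Ioi_iff_Ici, ContinuousWithinAt, hE0]
    exact hl0
  have key2 := integral_Ioi_of_hasDerivAt_of_tendsto (f := E) (m := 0) hcont hd hi hinf
  rw [hE0] at key2
  rw [integral_sub (h4.div_const 2) h2, integral_div] at key2
  linarith

lemma tail_contAt {k : ℝ → ℝ} (hi : ∀ r, 0 < r → IntegrableOn k (Ioi r)) {r : ℝ} (hr : 0 < r) :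
    ContinuousAt (fun x => ∫ t in Ioi x, k t) r := by
  have ha : 0 < r / 2 := by linarith
  have h1 : IntervalIntegrable k volume (r/2) (r+1) := by
    rw [intervalIntegrable_iff_integrableOn_Ioc_of_le (by linarith)]
    exact (hi _ ha).mono_set Ioc_subset_Ioi_self
  have h2 := intervalIntegral.continuousOn_primitive_interval' h1 (left_mem_uIcc)
  rw [uIcc_of_le (by linarith)] at h2
  have h3 : ContinuousAt (fun x => (∫ t in Ioi (r/2), k t) - ∫ t in (r/2)..x, k t) r :=
    continuousAt_const.sub (h2.continuousAt (Icc_mem_nhds (by linarith) (by linarith)))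
  refine h3.congr ?_
  filter_upwards [Ioi_mem_nhds (show r/2 < r by linarith)] with x hx
  rw [← intervalIntegral.integral_Ioi_sub_Ioi (hi _ ha) (le_of_lt hx)]; ring

lemma tail_deriv {k : ℝ → ℝ} (hi : ∀ r, 0 < r → IntegrableOn k (Ioi r)) (hc : ContinuousOn k (Ioi 0)) {r : ℝ} (hr : 0 < r) :
    HasDerivAt (fun x => ∫ t in Ioi x, k t) (-(k r)) r := by
  have ha : 0 < r / 2 := by linarith
  have h1 : IntervalIntegrable k volume (r/2) r := by
    rw [intervalIntegrable_iff_integrableOn_Ioc_of_le (by linarith)]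
    exact (hi _ ha).mono_set Ioc_subset_Ioi_self
  have h2 := intervalIntegral.integral_hasDerivAt_right h1
    (hc.stronglyMeasurableAtFilter isOpen_Ioi _ hr) (hc.continuousAt (Ioi_mem_nhds hr))
  have h3 := h2.const_sub (∫ t in Ioi (r/2), k t)
  refine h3.congr_of_eventuallyEq ?_
  filter_upwards [Ioi_mem_nhds (show r/2 < r by linarith)] with x hx
  rw [← intervalIntegral.integral_Ioi_sub_Ioi (hi _ ha) (le_of_lt hx)]; ring

lemma prim_contAt {f : ℝ → ℝ} (hi : ∀ r, 0 < r → IntegrableOn f (Ioc 0 r)) {r : ℝ} (hr : 0 < r) :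
    ContinuousAt (fun x => ∫ t in Ioc 0 x, f t) r := by
  have h1 : IntervalIntegrable f volume 0 (r+1) := by
    rw [intervalIntegrable_iff_integrableOn_Ioc_of_le (by linarith)]
    exact hi _ (by linarith)
  have h2 := intervalIntegral.continuousOn_primitive_interval' h1 (left_mem_uIcc)
  rw [uIcc_of_le (by linarith)] at h2
  refine (h2.continuousAt (Icc_mem_nhds hr (by linarith))).congr ?_
  filter_upwards [Ioi_mem_nhds hr] with x hx
  rw [intervalIntegral.integral_of_le (le_of_lt hx)]

lemma prim_deriv {f : ℝ → ℝ} (hi : ∀ r, 0 < r → IntegrableOn f (Ioc 0 r)) (hc : ContinuousOn f (Ioi 0)) {r : ℝ} (hr : 0 < r) :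
    HasDerivAt (fun x => ∫ t in Ioc 0 x, f t) (f r) r := by
  have h1 : IntervalIntegrable f volume 0 r := by
    rw [intervalIntegrable_iff_integrableOn_Ioc_of_le hr.le]
    exact hi _ hr
  have h2 := intervalIntegral.integral_hasDerivAt_right h1
    (hc.stronglyMeasurableAtFilter isOpen_Ioi _ hr) (hc.continuousAt (Ioi_mem_nhds hr))
  refine h2.congr_of_eventuallyEq ?_
  filter_upwards [Ioi_mem_nhds hr] with x hx
  rw [intervalIntegral.integral_of_le (le_of_lt hx)]

lemma kt_int {r : ℝ} (hr : 0 < r) : IntegrableOn (fun t => 1 / (t * bI t ^ 2)) (Ioi r) := by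
  have h1 : IntegrableOn (fun t => kf r t ^ 2) (Ioi r) := IntegrableOn.mono_set (kf_sq_int hr) (Ioi_subset_Ioi hr.le)
  refine IntegrableOn.congr_fun (h1.const_mul ((bI r ^ 2)⁻¹)) (fun t ht => ?_) measurableSet_Ioi
  have ht : r < t := ht
  have ht0 : 0 < t := hr.trans ht
  have := bI_pos r; have := bI_pos t
  simp only [kf, if_pos ht, div_pow, mul_pow, sq_sqrt ht0.le]
  field_simp

lemma kt_pos {r : ℝ} (hr : 0 < r) : 0 < kt r := by
  unfold kt
  have hnn : ∀ t ∈ Ioi r, 0 < 1 / (t * bI t ^ 2) := by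
    intro t ht
    have ht0 : 0 < t := hr.trans ht
    have := bI_pos t
    positivity
  rw [setIntegral_pos_iff_support_of_nonneg_ae]
  · have : Ioi r ⊆ Function.support (fun t => 1 / (t * bI t ^ 2)) ∩ Ioi r := fun t ht => ⟨(hnn t ht).ne', ht⟩
    refine lt_of_lt_of_le ?_ (measure_mono this)
    simp
  · filter_upwards [ae_restrict_mem measurableSet_Ioi] with t ht
    exact (hnn t ht).le
  · exact kt_int hr

lemma kt_deriv {r : ℝ} (hr : 0 < r) : HasDerivAt kt (-(1 / (r * bI r ^ 2))) r := by
  refine tail_deriv (k := fun t => 1 / (t * bI t ^ 2)) (fun r hr => kt_int hr) ?_ hr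
  intro t ht
  have ht : 0 < t := ht
  have := bI_pos t
  have := bI_cont.continuousAt (x := t)
  refine ContinuousAt.continuousWithinAt ?_
  exact continuousAt_const.div (continuousAt_id.mul (this.pow 2)) (by simp; constructor <;> positivity)

structure Pre (u : ℝ → ℝ) (S C C2 : ℝ) : Prop where
  S0 : 0 < S
  C0 : 0 ≤ C
  nn : ∀ r, 0 < r → 0 ≤ u r
  ne : ∃ r, 0 < r ∧ u r ≠ 0
  b4 : ∀ r, 0 < r → r * u r ^ 4 ≤ C
  b2 : ∀ r, 0 < r → r * u r ^ 2 ≤ C2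
  i2 : IntegrableOn (fun r => r * u r ^ 2) (Ioi 0)
  i4 : IntegrableOn (fun r => r * u r ^ 4) (Ioi 0)
  f0 : ∀ r, 0 < r → IntegrableOn (fun s => s * bI s * u s ^ 3) (Ioc 0 r)
  f1 : ∀ r, 0 < r → IntegrableOn (fun s => s * bI s * u s ^ 3 * kt s) (Ioi r)
  eq : ∀ r, 0 < r → S * u r = bI r * (kt r * (∫ s in Ioc 0 r, s * bI s * u s ^ 3) + ∫ s in Ioi r, s * bI s * u s ^ 3 * kt s)

def P0 (u : ℝ → ℝ) (r : ℝ) : ℝ := ∫ s in Ioc 0 r, s * bI s * u s ^ 3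
def ww (u : ℝ → ℝ) (r : ℝ) : ℝ := u r / bI r
def uu1 (u : ℝ → ℝ) (S r : ℝ) : ℝ := bD r * ww u r - P0 u r / (S * r * bI r)

namespace Pre
variable {u : ℝ → ℝ} {S C C2 : ℝ}

lemma ww_eq (h : Pre u S C C2) {r : ℝ} (hr : 0 < r) :
    ww u r = (kt r * P0 u r + ∫ s in Ioi r, s * bI s * u s ^ 3 * kt s) / S := by
  have := h.eq r hr
  have hb := bI_pos r
  have hS := h.S0
  unfold ww P0
  rw [div_eq_div_iff hb.ne' hS.ne']
  linarith

lemma u_contOn (h : Pre u S C C2) : ContinuousOn u (Ioi 0) := by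
  intro r hr
  have hr : 0 < r := hr
  refine ContinuousAt.continuousWithinAt ?_
  have h1 : ContinuousAt (fun r => bI r * ((kt r * P0 u r + ∫ s in Ioi r, s * bI s * u s ^ 3 * kt s) / S)) r :=
    bI_cont.continuousAt.mul ((((kt_deriv hr).continuousAt.mul (prim_contAt h.f0 hr)).add (tail_contAt h.f1 hr)).div_const S)
  refine h1.congr ?_
  filter_upwards [Ioi_mem_nhds hr] with x hx
  rw [← h.ww_eq hx]
  unfold ww
  have := bI_pos x
  field_simp

lemma kt_contOn : ContinuousOn kt (Ioi 0) := fun r hr => (kt_deriv hr).continuousAt.continuousWithinAt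

lemma f_contOn (h : Pre u S C C2) : ContinuousOn (fun s => s * bI s * u s ^ 3) (Ioi 0) :=
  (continuousOn_id.mul bI_cont.continuousOn).mul (h.u_contOn.pow 3)

lemma P0_deriv (h : Pre u S C C2) {r : ℝ} (hr : 0 < r) : HasDerivAt (P0 u) (r * bI r * u r ^ 3) r :=
  prim_deriv h.f0 h.f_contOn hr

lemma ww_deriv (h : Pre u S C C2) {r : ℝ} (hr : 0 < r) :
    HasDerivAt (ww u) (-(P0 u r / (S * r * bI r ^ 2))) r := by
  have h1 := (((kt_deriv hr).mul (h.P0_deriv hr)).add (tail_deriv h.f1 (h.f_contOn.mul kt_contOn) hr)).div_const S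
  have h2 : HasDerivAt (ww u) _ r := h1.congr_of_eventuallyEq (by
    filter_upwards [Ioi_mem_nhds hr] with x hx
    rw [h.ww_eq hx]; rfl)
  refine h2.congr_deriv ?_
  have := bI_pos r
  have := h.S0
  field_simp
  ring

lemma u_eq (u : ℝ → ℝ) (r : ℝ) : u r = bI r * ww u r := by
  unfold ww
  have := bI_pos r
  field_simp

lemma u_deriv (h : Pre u S C C2) {r : ℝ} (hr : 0 < r) : HasDerivAt u (uu1 u S r) r := by
  have h1 := (hasDerivAt_bI r).mul (h.ww_deriv hr)
  have h2 : HasDerivAt u _ r := h1.congr_of_eventuallyEq (Eventually.of_forall fun x => u_eq u x)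
  refine h2.congr_deriv ?_
  unfold uu1
  have := bI_pos r
  have := h.S0
  field_simp
  ring

lemma u1_deriv (h : Pre u S C C2) {r : ℝ} (hr : 0 < r) :
    HasDerivAt (uu1 u S) (-(uu1 u S r) / r + u r - u r ^ 3 / S) r := by
  have hb := bI_pos r
  have hS := h.S0
  have hid := hasDerivAt_id r
  have h1 := ((hasDerivAt_bD hr.ne').mul (h.ww_deriv hr)).sub
    ((h.P0_deriv hr).div (((hid.const_mul S)).mul (hasDerivAt_bI r)) (by simp; refine ⟨⟨?_, ?_⟩, ?_⟩ <;> positivity))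
  have h2 : HasDerivAt (uu1 u S) _ r := h1
  refine h2.congr_deriv ?_
  have e : ww u r = u r / bI r := rfl
  unfold uu1
  rw [e]
  simp
  field_simp
  ring

lemma P0_nonneg (h : Pre u S C C2) (r : ℝ) : 0 ≤ P0 u r := by
  refine setIntegral_nonneg measurableSet_Ioc fun s hs => ?_
  have := h.nn s hs.1; have := bI_pos s; have := hs.1
  positivity

lemma P0_mono (h : Pre u S C C2) {r r' : ℝ} (hr : 0 < r) (hrr : r ≤ r') : P0 u r ≤ P0 u r' := by
  refine setIntegral_mono_set (h.f0 r' (hr.trans_le hrr)) ?_ (Ioc_subset_Ioc_right hrr).eventuallyLE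
  filter_upwards [ae_restrict_mem measurableSet_Ioc] with s hs
  have := h.nn s hs.1; have := bI_pos s; have := hs.1
  simp only [Pi.zero_apply]; positivity

lemma P0_le (h : Pre u S C C2) {r : ℝ} (hr : 0 < r) : P0 u r ≤ r * (bI r * √√(r * C ^ 3)) := by
  have h1 : ∫ s in Ioc 0 r, s * bI s * u s ^ 3 ≤ ∫ s in Ioc 0 r, bI r * √√(r * C ^ 3) := by
    refine setIntegral_mono_on (h.f0 r hr) (integrableOn_const (by simp)) measurableSet_Ioc fun s hs => ?_
    have hs0 := hs.1
    have h2 := h.nn s hs0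
    have h3 := h.b4 s hs0
    have hb := bI_pos s
    have h4 : bI s ≤ bI r := bI_mono hs0.le hr.le hs.2
    have h5 : s * u s ^ 3 ≤ √√(r * C ^ 3) := by
      refine le_sqrt_of_sq_le (le_sqrt_of_sq_le ?_)
      calc ((s * u s ^ 3) ^ 2) ^ 2 = s * (s * u s ^ 4) ^ 3 := by ring
        _ ≤ r * C ^ 3 := by gcongr; exact hs.2
    calc s * bI s * u s ^ 3 = bI s * (s * u s ^ 3) := by ring
      _ ≤ _ := mul_le_mul h4 h5 (by positivity) (bI_pos r).le
  unfold P0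
  simpa [hr.le] using h1

lemma ww_anti (h : Pre u S C C2) : AntitoneOn (ww u) (Ioi 0) := by
  refine antitoneOn_of_deriv_nonpos (convex_Ioi 0) (fun r hr => (h.ww_deriv hr).continuousAt.continuousWithinAt) ?_ ?_
  · rw [interior_Ioi]
    exact fun r hr => (h.ww_deriv hr).differentiableAt.differentiableWithinAt
  · rw [interior_Ioi]
    intro r hr
    have hr : 0 < r := hr
    rw [(h.ww_deriv hr).deriv]
    have := h.P0_nonneg r; have := h.S0; have := bI_pos r
    rw [neg_nonpos]
    positivity

lemma ww_nonneg (h : Pre u S C C2) {r : ℝ} (hr : 0 < r) : 0 ≤ ww u r := div_nonneg (h.nn r hr) (bI_pos r).le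

lemma ww_pos (h : Pre u S C C2) {r : ℝ} (hr : 0 < r) : 0 < ww u r := by
  refine lt_of_le_of_ne (h.ww_nonneg hr) fun h0 => ?_
  have h1 : ∀ x, r ≤ x → ww u x = 0 := fun x hx =>
    le_antisymm (h0 ▸ h.ww_anti hr (hr.trans_le hx) hx) (h.ww_nonneg (hr.trans_le hx))
  have h2 : ∀ x, r < x → P0 u x = 0 := by
    intro x hx
    have hx0 : 0 < x := hr.trans hx
    have d1 := h.ww_deriv hx0
    have d2 : HasDerivAt (ww u) 0 x := (hasDerivAt_const x (0:ℝ)).congr_of_eventuallyEq (by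
      filter_upwards [Ioi_mem_nhds hx] with y hy using h1 y (le_of_lt hy))
    have e := d1.unique d2
    have := h.S0; have := bI_pos x
    rw [neg_eq_zero, div_eq_zero_iff] at e
    rcases e with e | e
    · exact e
    · exfalso
      have : 0 < S * x * bI x ^ 2 := by positivity
      linarith
  have h3 : ∀ x, 0 < x → P0 u x = 0 := by
    intro x hx
    have hm : r < max x (r+1) := lt_of_lt_of_le (by linarith) (le_max_right _ _)
    have := h.P0_mono hx (le_max_left x (r+1))
    rw [h2 _ hm] at this
    exact le_antisymm this (h.P0_nonneg x)
  have h4 : ∀ x, 0 < x → ww u x = 0 := by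
    intro x hx
    have := Convex.norm_image_sub_le_of_norm_hasDerivWithin_le (f := ww u) (f' := fun _ => 0) (s := Ioi 0) (C := 0)
      (x := r) (y := x)
      (fun y hy => by
        have := (h.ww_deriv hy).hasDerivWithinAt (s := Ioi 0)
        rw [h3 y hy] at this; simpa using this) (by simp) (convex_Ioi 0) hr hx
    rw [zero_mul, norm_le_zero_iff, ← h0, sub_zero] at this
    exact this
  obtain ⟨x, hx, hne⟩ := h.ne
  exact hne (by rw [u_eq u x, h4 x hx, mul_zero])

lemma q4_tendsto (C : ℝ) : Tendsto (fun r : ℝ => √√(r * C ^ 3)) (𝓝[>] 0) (𝓝 0) := by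
  have : Continuous (fun r : ℝ => √√(r * C ^ 3)) := by fun_prop
  have := this.tendsto 0
  simp at this
  exact this.mono_left nhdsWithin_le_nhds

lemma P0_div_le (h : Pre u S C C2) {r : ℝ} (hr : 0 < r) : P0 u r / (S * r * bI r) ≤ √√(r * C ^ 3) / S := by
  have := h.P0_le hr
  have := h.S0; have := bI_pos r
  rw [div_le_div_iff₀ (by positivity) (by positivity)]
  nlinarith

lemma ww_bdd (h : Pre u S C C2) : BddAbove (ww u '' Ioi 0) := by
  have hS := h.S0
  have hb0 := bI_pos 0
  set M := √√(1 * C ^ 3) / S / bI 0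
  have hM : 0 ≤ M := by positivity
  have hd : ∀ x ∈ Ioc (0:ℝ) 1, ‖-(P0 u x / (S * x * bI x ^ 2))‖ ≤ M := by
    intro x hx
    have hx0 := hx.1
    have hb := bI_pos x
    have hp := h.P0_nonneg x
    rw [norm_neg, Real.norm_of_nonneg (by positivity)]
    have h1 := h.P0_div_le hx0
    have h2 : bI 0 ≤ bI x := bI_mono (by simp) hx0.le hx0.le
    have hC := h.C0
    calc P0 u x / (S * x * bI x ^ 2) = P0 u x / (S * x * bI x) / bI x := by field_simp
      _ ≤ √√(x * C ^ 3) / S / bI x := by gcongr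
      _ ≤ √√(1 * C ^ 3) / S / bI 0 := by
        have h3 := hx.2
        gcongr
  refine ⟨ww u 1 + M, ?_⟩
  rintro _ ⟨x, hx, rfl⟩
  have hx : 0 < x := hx
  rcases le_total x 1 with h1 | h1
  · have := Convex.norm_image_sub_le_of_norm_hasDerivWithin_le (f := ww u) (s := Ioc 0 1) (C := M)
      (x := 1) (y := x) (fun y hy => (h.ww_deriv hy.1).hasDerivWithinAt) hd (convex_Ioc 0 1) (by simp) ⟨hx, h1⟩
    have h2 : ‖x - 1‖ ≤ 1 := by rw [norm_eq_abs, abs_le]; constructor <;> linarith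
    have h3 := le_norm_self (ww u x - ww u 1)
    nlinarith
  · have := h.ww_anti (show (0:ℝ) < 1 by norm_num) hx h1
    linarith

lemma u1_le (h : Pre u S C C2) {r : ℝ} (hr : 0 < r) : uu1 u S r ≤ u r := by
  have hp := h.P0_nonneg r
  have hS := h.S0
  have hb := bI_pos r
  have h1 : 0 ≤ P0 u r / (S * r * bI r) := by positivity
  have h2 := mul_le_mul_of_nonneg_right (bD_le r) (h.ww_nonneg hr)
  rw [← u_eq u r] at h2
  unfold uu1
  linarith

lemma ww_lim (h : Pre u S C C2) : Tendsto (ww u) (𝓝[>] 0) (𝓝 (sSup (ww u '' Ioi 0))) :=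
  h.ww_anti.tendsto_nhdsGT h.ww_bdd

lemma u_lim (h : Pre u S C C2) : Tendsto u (𝓝[>] 0) (𝓝 (bI 0 * sSup (ww u '' Ioi 0))) := by
  have h1 := ((bI_cont.tendsto 0).mono_left (nhdsWithin_le_nhds (s := Ioi 0))).mul h.ww_lim
  exact h1.congr fun r => (u_eq u r).symm

lemma u1_lim (h : Pre u S C C2) : Tendsto (uu1 u S) (𝓝[>] 0) (𝓝 0) := by
  have h1 := ((bD_cont.tendsto 0).mono_left (nhdsWithin_le_nhds (s := Ioi 0))).mul h.ww_lim
  have h0 : bD 0 = 0 := by rw [bD_eq, zero_mul]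
  rw [h0, zero_mul] at h1
  have h2 : Tendsto (fun r => P0 u r / (S * r * bI r)) (𝓝[>] 0) (𝓝 0) := by
    have hq := (q4_tendsto C).div_const S
    rw [zero_div] at hq
    refine squeeze_zero' ?_ ?_ hq
    · filter_upwards [self_mem_nhdsWithin] with r hr
      have hr : 0 < r := hr
      have := h.P0_nonneg r; have := h.S0; have := bI_pos r
      positivity
    · filter_upwards [self_mem_nhdsWithin] with r hr using h.P0_div_le hr
  have := h1.sub h2
  rw [sub_zero] at this
  exact this

lemma u1_contOn (h : Pre u S C C2) : ContinuousOn (uu1 u S) (Ioi 0) :=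
  fun r hr => (h.u1_deriv hr).continuousAt.continuousWithinAt

lemma u1_int (h : Pre u S C C2) : IntegrableOn (fun r => r * uu1 u S r ^ 2) (Ioi 0) := by
  have hS := h.S0
  have hcont : ContinuousOn (fun r => r * uu1 u S r ^ 2) (Ioi 0) := continuousOn_id.mul (h.u1_contOn.pow 2)
  have hmeas : ∀ s ⊆ Ioi (0:ℝ), MeasurableSet s → AEStronglyMeasurable (fun r => r * uu1 u S r ^ 2) (volume.restrict s) :=
    fun s hs hm => (hcont.mono hs).aestronglyMeasurable hm
  -- near zero
  have hev : ∀ᶠ r in 𝓝[>] (0:ℝ), |uu1 u S r| < 1 := by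
    have := h.u1_lim.abs
    rw [abs_zero] at this
    exact this.eventually_lt_const one_pos
  obtain ⟨δ, hδ, hδ1⟩ := mem_nhdsGT_iff_exists_Ioo_subset.1 hev
  have hδ : 0 < δ := hδ
  set a := δ / 2 with ha
  have ha0 : 0 < a := by positivity
  have I1 : IntegrableOn (fun r => r * uu1 u S r ^ 2) (Ioc 0 a) := by
    refine Integrable.mono' (g := fun _ => a) (integrableOn_const (by simp)) (hmeas _ Ioc_subset_Ioi_self measurableSet_Ioc) ?_
    filter_upwards [ae_restrict_mem measurableSet_Ioc] with r hr
    have hr0 := hr.1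
    have h1 : |uu1 u S r| < 1 := hδ1 ⟨hr.1, by have := hr.2; linarith⟩
    rw [Real.norm_of_nonneg (by positivity)]
    have h2 : uu1 u S r ^ 2 ≤ 1 := by rw [← sq_abs]; exact pow_le_one₀ (abs_nonneg _) h1.le
    have := hr.2
    nlinarith
  have I2 : IntegrableOn (fun r => r * uu1 u S r ^ 2) (Ioi a) := by
    have hii : ∀ (k : ℝ → ℝ), ContinuousOn k (Ioi 0) → ∀ n : ℕ, IntervalIntegrable k volume a (a + n) := by
      intro k hk n
      refine ContinuousOn.intervalIntegrable (hk.mono ?_)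
      rw [uIcc_of_le (by simp)]
      exact fun x hx => ha0.trans_le hx.1
    have c2 : ContinuousOn (fun r => r * u r ^ 2) (Ioi 0) := continuousOn_id.mul (h.u_contOn.pow 2)
    have c4 : ContinuousOn (fun r => r * u r ^ 4) (Ioi 0) := continuousOn_id.mul (h.u_contOn.pow 4)
    refine integrableOn_Ioi_of_intervalIntegral_norm_bounded (b := fun n : ℕ => a + n) (l := atTop)
      (C2 + |a * (u a * uu1 u S a)| + (∫ r in Ioi (0:ℝ), r * u r ^ 4) / S) a ?_ ?_ ?_
    · intro n
      exact (intervalIntegrable_iff_integrableOn_Ioc_of_le (by simp)).1 (hii _ hcont n)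
    · exact tendsto_atTop_add_const_left _ _ tendsto_natCast_atTop_atTop
    · refine Eventually.of_forall fun n => ?_
      have hle : a ≤ a + n := by simp
      have e1 : ∫ r in a..(a + n), ‖r * uu1 u S r ^ 2‖ = ∫ r in a..(a + n), r * uu1 u S r ^ 2 := by
        refine intervalIntegral.integral_congr fun r hr => ?_
        rw [uIcc_of_le hle] at hr
        have : 0 < r := ha0.trans_le hr.1
        exact Real.norm_of_nonneg (by positivity)
      have e2 : ∫ r in a..(a + n), ((r * uu1 u S r ^ 2 + r * u r ^ 2) - r * u r ^ 4 / S) =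
          (a + n) * (u (a + n) * uu1 u S (a + n)) - a * (u a * uu1 u S a) := by
        refine intervalIntegral.integral_eq_sub_of_hasDerivAt (f := fun r => r * (u r * uu1 u S r)) (fun r hr => ?_) ?_
        · rw [uIcc_of_le hle] at hr
          have hr0 : 0 < r := ha0.trans_le hr.1
          refine ((hasDerivAt_id r).mul ((h.u_deriv hr0).mul (h.u1_deriv hr0))).congr_deriv ?_
          simp only [Pi.mul_apply, id]
          field_simp
          ring
        · exact ((hii _ hcont n).add (hii _ c2 n)).sub ((hii _ c4 n).div_const S)
      rw [intervalIntegral.integral_sub ((hii _ hcont n).add (hii _ c2 n)) ((hii _ c4 n).div_const S),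
        intervalIntegral.integral_add (hii _ hcont n) (hii _ c2 n), intervalIntegral.integral_div] at e2
      have hn0 : 0 < a + n := by positivity
      have b1 : (a + n) * (u (a + n) * uu1 u S (a + n)) ≤ C2 := by
        have := h.b2 _ hn0
        have h3 := h.u1_le hn0
        have h4 := h.nn _ hn0
        calc (a + n) * (u (a + n) * uu1 u S (a + n)) ≤ (a + n) * (u (a + n) * u (a + n)) := by gcongr
          _ = (a + n) * u (a + n) ^ 2 := by ring
          _ ≤ _ := this
      have b2 : 0 ≤ ∫ r in a..(a + n), r * u r ^ 2 := by
        refine intervalIntegral.integral_nonneg hle fun r hr => ?_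
        have : 0 < r := ha0.trans_le hr.1
        positivity
      have b3 : ∫ r in a..(a + n), r * u r ^ 4 ≤ ∫ r in Ioi (0:ℝ), r * u r ^ 4 := by
        rw [intervalIntegral.integral_of_le hle]
        have hsub : Ioc a (a + n) ⊆ Ioi 0 := fun x hx => ha0.trans hx.1
        refine setIntegral_mono_set h.i4 ?_ hsub.eventuallyLE
        · filter_upwards [ae_restrict_mem measurableSet_Ioi] with r hr
          have hr : 0 < r := hr
          simp only [Pi.zero_apply]; positivity
      have b4 : (∫ r in a..(a + n), r * u r ^ 4) / S ≤ (∫ r in Ioi (0:ℝ), r * u r ^ 4) / S := by gcongr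
      rw [e1]
      have := neg_abs_le (a * (u a * uu1 u S a))
      linarith
  rw [← Ioc_union_Ioi_eq_Ioi ha0.le]
  exact I1.union I2

theorem radSol (h : Pre u S C C2) : RadSol (fun r => u r / √S) (fun r => uu1 u S r / √S) (bI 0 * sSup (ww u '' Ioi 0) / √S) := by
  have hS := h.S0
  have hq : 0 < √S := sqrt_pos.2 hS
  have hqq : √S ^ 2 = S := sq_sqrt hS.le
  refine ⟨fun r hr => ?_, fun r hr => (h.u_deriv hr).div_const _, fun r hr => ?_, ?_, h.u_lim.div_const _, ?_, ?_⟩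
  · have := h.ww_pos hr; have := bI_pos r
    rw [u_eq u r]; positivity
  · refine ((h.u1_deriv hr).div_const √S).congr_deriv ?_
    have : √S ^ 3 = S * √S := by rw [pow_succ, hqq]
    rw [div_pow, this]
    field_simp
  · have h1 := h.ww_pos one_pos
    have h2 : ww u 1 ≤ sSup (ww u '' Ioi 0) := le_csSup h.ww_bdd ⟨1, by simp, rfl⟩
    have := bI_pos 0
    have : 0 < sSup (ww u '' Ioi 0) := h1.trans_le h2
    positivity
  · have := h.u1_lim.div_const √S
    rwa [zero_div] at this
  · have h1 := ((h.i2.const_mul (1 / S)).add (h.u1_int.const_mul (1 / S))).add (h.i4.const_mul (1 / S ^ 2))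
    refine h1.congr (Eventually.of_forall fun r => ?_)
    have h4 : √S ^ 4 = S ^ 2 := by
      calc √S ^ 4 = (√S ^ 2) ^ 2 := by ring
        _ = _ := by rw [hqq]
    simp only [Pi.add_apply, div_pow, hqq, h4]
    ring

end Pre

theorem pre_of_max {S : ℝ} {g : HH} (hS0 : 0 < S) (hn : ‖g‖ = 1) (hS : FF g = S) (hg : ∀ᵐ t ∂muH, 0 ≤ g t)
    (hsup : ∀ h, FF h ≤ S * ‖h‖ ^ 4) : ∃ C C2, Pre (UU g) S C C2 := by
  obtain ⟨C, hC, hCb⟩ := U4_bound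
  have hEL := euler_lagrange hn hS hsup
  have hk : ∀ r s, 0 < r → 0 < s → UU (kL r) s = bI s * bI r * kt (max s r) := fun r s hr hs => inner_kL hs hr
  have hinteg : ∀ r, 0 < r → IntegrableOn (fun s => s * UU g s ^ 3 * (bI s * bI r * kt (max s r))) (Ioi 0) := by
    intro r hr
    refine IntegrableOn.congr_fun (f := fun s => s * UU g s ^ 3 * UU (kL r) s) (U31_int g (kL r)) (fun s hs => ?_) measurableSet_Ioi
    simp only [hk r s hr hs]
  have f0 : ∀ r, 0 < r → IntegrableOn (fun s => s * bI s * UU g s ^ 3) (Ioc 0 r) := by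
    intro r hr
    have h1 := ((hinteg r hr).mono_set (Ioc_subset_Ioi_self (a := r) (b := 0))).const_mul ((bI r * kt r)⁻¹)
    refine IntegrableOn.congr_fun h1 (fun s hs => ?_) measurableSet_Ioc
    have := kt_pos hr; have := bI_pos r
    simp only [max_eq_right hs.2]
    field_simp
  have f1 : ∀ r, 0 < r → IntegrableOn (fun s => s * bI s * UU g s ^ 3 * kt s) (Ioi r) := by
    intro r hr
    have h1 := ((hinteg r hr).mono_set (Ioi_subset_Ioi hr.le)).const_mul ((bI r)⁻¹)
    refine IntegrableOn.congr_fun h1 (fun s hs => ?_) measurableSet_Ioi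
    have := bI_pos r
    simp only [max_eq_left (le_of_lt (mem_Ioi.1 hs))]
    field_simp
  refine ⟨C, 2 * exp 1 ^ 2, hS0, hC, fun r hr => ?_, ?_, fun r hr => ?_, fun r hr => ?_, (hardy g).1, U4_int g, f0, f1, fun r hr => ?_⟩
  · rw [UU_eq g hr]
    refine integral_nonneg_of_ae ?_
    filter_upwards [hg] with t ht
    exact mul_nonneg (kf_nonneg r t) ht
  · by_contra hcon
    push Not at hcon
    have : FF g = 0 := by
      unfold FF
      rw [setIntegral_congr_fun (g := fun _ => (0:ℝ)) measurableSet_Ioi (fun r hr => by simp [hcon r hr])]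
      simp
    linarith
  · have := hCb g r hr
    simpa [hn] using this
  · have := U2_bound g hr
    simpa [hn] using this
  · have h1 := hEL (kL r)
    have e1 : S * UU g r = S * inner ℝ g (kL r) := by rw [UU, real_inner_comm]
    rw [e1, ← h1]
    have e2 : ∫ s, s * UU g s ^ 3 * UU (kL r) s ∂muH = ∫ s in Ioi 0, s * UU g s ^ 3 * (bI s * bI r * kt (max s r)) :=
      setIntegral_congr_fun measurableSet_Ioi fun s hs => by simp only [hk r s hr hs]
    rw [e2, ← Ioc_union_Ioi_eq_Ioi hr.le, setIntegral_union (Ioc_disjoint_Ioi le_rfl) measurableSet_Ioi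
      ((hinteg r hr).mono_set Ioc_subset_Ioi_self) ((hinteg r hr).mono_set (Ioi_subset_Ioi hr.le)), mul_add]
    congr 1
    · rw [← integral_const_mul, ← integral_const_mul]
      refine setIntegral_congr_fun measurableSet_Ioc fun s hs => ?_
      simp only [max_eq_right hs.2]; ring
    · rw [← integral_const_mul]
      refine setIntegral_congr_fun measurableSet_Ioi fun s hs => ?_
      simp only [max_eq_left (le_of_lt (mem_Ioi.1 hs))]; ring

/-- existence of a radial solution with the optimal constant -/
theorem exists_radSol (h0 : HH) (hF : 0 < FF h0) : ∃ S : ℝ, 0 < S ∧ FF h0 ≤ S * ‖h0‖ ^ 4 ∧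
    ∃ v v1 α, RadSol v v1 α ∧ ∫ r in Ioi (0:ℝ), r * v r ^ 4 = 1 / S := by
  obtain ⟨S, g, hS0, hn, hS, hg, hsup⟩ := exists_max h0 hF
  obtain ⟨C, C2, hP⟩ := pre_of_max hS0 hn hS hg hsup
  refine ⟨S, hS0, hsup h0, _, _, _, hP.radSol, ?_⟩
  have h4 : √S ^ 4 = S ^ 2 := by
    have := sq_sqrt hS0.le
    calc √S ^ 4 = (√S ^ 2) ^ 2 := by ring
      _ = _ := by rw [this]
  have e : ∀ r, r * (UU g r / √S) ^ 4 = (1 / S ^ 2) * (r * UU g r ^ 4) := by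
    intro r; rw [div_pow, h4]; ring
  simp only [e]
  rw [integral_const_mul]
  change 1 / S ^ 2 * FF g = _
  rw [hS]; field_simp

def tru (b p r : ℝ) : ℝ := exp (-b * r ^ p)
def tru1 (b p r : ℝ) : ℝ := -b * (p * r ^ (p - 1)) * tru b p r
def trg (b p r : ℝ) : ℝ := √r * (bD r / bI r * tru b p r - tru1 b p r)

section
variable {b p : ℝ}

lemma tru_deriv {r : ℝ} (hr : 0 < r) : HasDerivAt (tru b p) (tru1 b p r) r := by
  have h1 := ((Real.hasDerivAt_rpow_const (p := p) (Or.inl hr.ne')).const_mul (-b)).exp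
  refine h1.congr_deriv ?_
  unfold tru1 tru; ring

lemma tru_cont (hp : 0 < p) : Continuous (tru b p) := by
  unfold tru
  exact (continuous_const.mul (Real.continuous_rpow_const hp.le)).rexp

lemma tru1_contOn : ContinuousOn (tru1 b p) (Ioi 0) := by
  intro r hr
  have hr : 0 < r := hr
  refine ContinuousAt.continuousWithinAt ?_
  unfold tru1
  exact (continuousAt_const.mul (continuousAt_const.mul (Real.continuousAt_rpow_const _ _ (Or.inl hr.ne')))).mul (tru_deriv hr).continuousAt

lemma tru_pos (r : ℝ) : 0 < tru b p r := exp_pos _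

lemma tru_I2 (hb : 0 < b) (hp : 0 < p) : IntegrableOn (fun r => r * tru b p r ^ 2) (Ioi 0) ∧
    ∫ r in Ioi (0:ℝ), r * tru b p r ^ 2 = (2 * b) ^ (-(2 / p)) * (1 / p * Gamma (2 / p)) := by
  have e : ∀ r : ℝ, r * tru b p r ^ 2 = r ^ (1:ℝ) * exp (-(2 * b) * r ^ p) := by
    intro r; rw [rpow_one, tru, ← exp_nat_mul]; congr 2; push_cast; ring
  simp only [e]
  refine ⟨integrableOn_rpow_mul_exp_neg_mul_rpow (by norm_num) hp (by positivity), ?_⟩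
  rw [integral_rpow_mul_exp_neg_mul_rpow hp (by norm_num) (by positivity)]
  norm_num
  ring_nf

lemma tru_I4 (hb : 0 < b) (hp : 0 < p) : 
    ∫ r in Ioi (0:ℝ), r * tru b p r ^ 4 = (4 * b) ^ (-(2 / p)) * (1 / p * Gamma (2 / p)) := by
  have e : ∀ r : ℝ, r * tru b p r ^ 4 = r ^ (1:ℝ) * exp (-(4 * b) * r ^ p) := by
    intro r; rw [rpow_one, tru, ← exp_nat_mul]; congr 2; push_cast; ring
  simp only [e]
  rw [integral_rpow_mul_exp_neg_mul_rpow hp (by norm_num) (by positivity)]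
  norm_num
  ring_nf

lemma tru_ID (hb : 0 < b) (hp : 0 < p) : IntegrableOn (fun r => r * tru1 b p r ^ 2) (Ioi 0) ∧
    ∫ r in Ioi (0:ℝ), r * tru1 b p r ^ 2 = p / 4 := by
  have e : ∀ r ∈ Ioi (0:ℝ), (b * p) ^ 2 * (r ^ (2 * p - 1) * exp (-(2 * b) * r ^ p)) = r * tru1 b p r ^ 2 := by
    intro r hr
    have hr : 0 < r := hr
    have e1 : r ^ (2 * p - 1) = r * (r ^ (p - 1)) ^ 2 := by
      rw [← rpow_natCast (r ^ (p-1)), ← rpow_mul hr.le]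
      nth_rewrite 2 [← rpow_one r]
      rw [← rpow_add hr]; congr 1; push_cast; ring
    have e2 : exp (-(2 * b) * r ^ p) = tru b p r ^ 2 := by
      rw [tru, ← exp_nat_mul]; congr 1; push_cast; ring
    rw [e1, e2]; unfold tru1; ring
  constructor
  · refine IntegrableOn.congr_fun ?_ e measurableSet_Ioi
    exact (integrableOn_rpow_mul_exp_neg_mul_rpow (by linarith) hp (by positivity)).const_mul _
  · rw [← setIntegral_congr_fun measurableSet_Ioi e, integral_const_mul,
      integral_rpow_mul_exp_neg_mul_rpow hp (by linarith) (by positivity)]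
    have e3 : (2 * p - 1 + 1) / p = 2 := by field_simp; ring
    have e4 : -(2 * p - 1 + 1) / p = -2 := by rw [neg_div, e3]
    rw [e3, e4, Gamma_two, rpow_neg (by positivity)]
    norm_num
    field_simp
    ring

lemma tru_decay (hb : 0 < b) (hp : 0 < p) : Tendsto (fun r => r * tru b p r ^ 2) atTop (𝓝 0) := by
  have h1 := (tendsto_rpow_mul_exp_neg_mul_atTop_nhds_zero (1 / p) (2 * b) (by positivity)).comp (tendsto_rpow_atTop hp)
  refine h1.congr' ?_
  filter_upwards [eventually_gt_atTop 0] with r hr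
  simp only [Function.comp]
  rw [← rpow_mul hr.le, mul_one_div_cancel hp.ne', rpow_one, tru, ← exp_nat_mul]
  congr 2; push_cast; ring

lemma tru_lim (hb : 0 < b) (hp : 0 < p) : Tendsto (tru b p) atTop (𝓝 0) := by
  have h1 := tendsto_exp_atBot.comp ((tendsto_rpow_atTop hp).const_mul_atTop_of_neg (show -b < 0 by linarith))
  exact h1

lemma trg_sq {r : ℝ} (hr : 0 < r) : trg b p r ^ 2 = r * (tru1 b p r - bD r / bI r * tru b p r) ^ 2 := by
  unfold trg; rw [mul_pow, sq_sqrt hr.le]; ring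

lemma y_bd {r : ℝ} (hr : 0 ≤ r) : 0 ≤ bD r / bI r ∧ bD r / bI r ≤ 1 :=
  ⟨div_nonneg (bD_nonneg hr) (bI_pos r).le, (div_le_one (bI_pos r)).2 (bD_le r)⟩

lemma trg_meas (hp : 0 < p) : AEStronglyMeasurable (trg b p) muH := by
  refine ContinuousOn.aestronglyMeasurable ?_ measurableSet_Ioi
  unfold trg
  have h1 : Continuous (fun r => bD r / bI r) := bD_cont.div bI_cont fun r => (bI_pos r).ne'
  exact continuous_sqrt.continuousOn.mul ((h1.continuousOn.mul (tru_cont hp).continuousOn).sub tru1_contOn)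

lemma trg_memLp (hb : 0 < b) (hp : 0 < p) : MemLp (trg b p) 2 muH := by
  rw [memLp_two_iff_integrable_sq (trg_meas hp)]
  refine Integrable.mono' (((tru_ID hb hp).1.add (tru_I2 hb hp).1).const_mul 2) ((trg_meas hp).pow 2) ?_
  filter_upwards [ae_restrict_mem measurableSet_Ioi] with r hr
  have hr : 0 < r := hr
  rw [Real.norm_of_nonneg (sq_nonneg _), trg_sq hr]
  obtain ⟨h1, h2⟩ := y_bd hr.le
  simp only [Pi.add_apply]
  set y := bD r / bI r
  set v := tru b p r
  set v1 := tru1 b p r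
  have hy : y ^ 2 ≤ 1 := pow_le_one₀ h1 h2
  have h3 : (v1 - y * v) ^ 2 ≤ 2 * (v1 ^ 2 + v ^ 2) := by
    nlinarith [sq_nonneg (v1 + y * v), sq_nonneg v]
  calc _ ≤ r * (2 * (v1 ^ 2 + v ^ 2)) := by gcongr
    _ = _ := by ring

def trL (b p : ℝ) (hb : 0 < b) (hp : 0 < p) : HH := (trg_memLp hb hp).toLp (trg b p)

lemma trL_UU (hb : 0 < b) (hp : 0 < p) {r : ℝ} (hr : 0 < r) : UU (trL b p hb hp) r = tru b p r := by
  have hi := UU_integrable (trL b p hb hp) hr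
  have hae : (fun t => kf r t * trL b p hb hp t) =ᵐ[muH] fun t => kf r t * trg b p t := by
    filter_upwards [(trg_memLp hb hp).coeFn_toLp] with t ht
    rw [trL, ht]
  rw [UU_eq _ hr, integral_congr_ae hae]
  have hi' := hi.congr hae
  have e : ∀ t ∈ Ioi r, kf r t * trg b p t = -bI r * ((tru1 b p t * bI t - tru b p t * bD t) / bI t ^ 2) := by
    intro t ht
    have ht' : r < t := ht
    have ht0 : 0 < √t := sqrt_pos.2 (hr.trans ht')
    have := bI_pos t
    unfold kf trg
    rw [if_pos ht']
    field_simp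
    ring
  have hi2 : IntegrableOn (fun t => -bI r * ((tru1 b p t * bI t - tru b p t * bD t) / bI t ^ 2)) (Ioi r) :=
    IntegrableOn.congr_fun (IntegrableOn.mono_set hi' (Ioi_subset_Ioi hr.le)) e measurableSet_Ioi
  have h1 : ∫ t, kf r t * trg b p t ∂muH = ∫ t in Ioi r, kf r t * trg b p t := by
    refine setIntegral_eq_of_subset_of_forall_sdiff_eq_zero measurableSet_Ioi (Ioi_subset_Ioi hr.le) ?_
    intro t ht
    have : ¬ r < t := ht.2
    simp [kf, this]
  rw [h1, setIntegral_congr_fun measurableSet_Ioi e]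
  rw [integral_Ioi_of_hasDerivAt_of_tendsto' (f := fun t => -bI r * (tru b p t / bI t)) (m := 0) ?_ hi2 ?_]
  · have := bI_pos r
    field_simp
    ring
  · intro t ht
    have ht0 : 0 < t := hr.trans_le ht
    exact ((tru_deriv ht0).div (hasDerivAt_bI t) (bI_pos t).ne').const_mul _
  · have h2 : Tendsto (fun t => tru b p t / bI t) atTop (𝓝 0) := by
      have h3 := (tru_lim hb hp).div_const (bI 0)
      rw [zero_div] at h3
      refine squeeze_zero' ?_ ?_ h3
      · exact Eventually.of_forall fun t => div_nonneg (tru_pos t).le (bI_pos t).le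
      · filter_upwards [eventually_gt_atTop 0] with t ht
        exact div_le_div_of_nonneg_left (tru_pos t).le (bI_pos 0) (bI_mono (by simp) ht.le ht.le)
    have := h2.const_mul (-bI r)
    rwa [mul_zero] at this

lemma trL_normsq (hb : 0 < b) (hp : 0 < p) : ‖trL b p hb hp‖ ^ 2 =
    (∫ r in Ioi (0:ℝ), r * tru1 b p r ^ 2) + ∫ r in Ioi (0:ℝ), r * tru b p r ^ 2 := by
  have e0 : ‖trL b p hb hp‖ ^ 2 = ∫ r in Ioi (0:ℝ), trg b p r ^ 2 := by
    rw [normsq_eq]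
    refine integral_congr_ae ?_
    filter_upwards [(trg_memLp hb hp).coeFn_toLp] with t ht
    rw [trL, ht]
  have hI : IntegrableOn (fun r => r * tru1 b p r ^ 2 + r * tru b p r ^ 2) (Ioi 0) := ((tru_ID hb hp).1.add (tru_I2 hb hp).1)
  have hg : IntegrableOn (fun r => trg b p r ^ 2) (Ioi 0) := (trg_memLp hb hp).integrable_sq
  rw [e0, ← integral_add (tru_ID hb hp).1 (tru_I2 hb hp).1, ← sub_eq_zero, ← integral_sub hg hI]
  have hcy : Continuous (fun r => bD r / bI r) := bD_cont.div bI_cont fun r => (bI_pos r).ne'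
  have hc : Continuous (fun r => -(r * (bD r / bI r) * tru b p r ^ 2)) :=
    ((continuous_id.mul hcy).mul ((tru_cont hp).pow 2)).neg
  have hD : IntegrableOn (fun r => trg b p r ^ 2 - (r * tru1 b p r ^ 2 + r * tru b p r ^ 2)) (Ioi 0) := hg.sub hI
  rw [integral_Ioi_of_hasDerivAt_of_tendsto (f := fun r => -(r * (bD r / bI r) * tru b p r ^ 2)) (m := 0)
    hc.continuousWithinAt ?_ hD ?_]
  · simp
  · intro r hr
    have hr : 0 < r := hr
    have hbI := bI_pos r
    have h1 := (((hasDerivAt_id r).mul ((hasDerivAt_bD hr.ne').div (hasDerivAt_bI r) hbI.ne')).mul ((tru_deriv (b := b) (p := p) hr).pow 2)).neg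
    refine h1.congr_deriv ?_
    rw [trg_sq hr]
    simp
    field_simp
    ring
  · have h3 := tru_decay hb hp
    have : Tendsto (fun r => r * (bD r / bI r) * tru b p r ^ 2) atTop (𝓝 0) := by
      refine squeeze_zero' ?_ ?_ h3
      · filter_upwards [eventually_gt_atTop 0] with t ht
        have := (y_bd ht.le).1
        positivity
      · filter_upwards [eventually_gt_atTop 0] with t ht
        have h1 := (y_bd ht.le)
        have h2 : t * (bD t / bI t) ≤ t := mul_le_of_le_one_right ht.le h1.2
        exact mul_le_mul_of_nonneg_right h2 (sq_nonneg _)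
    have := this.neg
    rwa [neg_zero] at this

lemma trL_FF (hb : 0 < b) (hp : 0 < p) : FF (trL b p hb hp) = ∫ r in Ioi (0:ℝ), r * tru b p r ^ 4 :=
  setIntegral_congr_fun measurableSet_Ioi fun r hr => by simp only [trL_UU hb hp hr]

end

theorem trial : ∃ h0 : HH, 0 < FF h0 ∧ ‖h0‖ ^ 4 = 2 * log 2 * exp 1 * FF h0 := by
  set p : ℝ := 2 * log 2 with hpdef
  have hl : 0 < log 2 := log_pos (by norm_num)
  have hp : 0 < p := by positivity
  set G : ℝ := 1 / p * Gamma (2 / p) with hG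
  have hGp : 0 < G := by have := Gamma_pos_of_pos (show 0 < 2 / p by positivity); positivity
  set c : ℝ := (p / (4 * G)) ^ (-(p / 2)) with hc
  have hcp : 0 < c := by positivity
  have hcm : c ^ (-(2 / p)) = p / (4 * G) := by
    rw [hc, ← rpow_mul (by positivity)]
    have : -(p / 2) * -(2 / p) = 1 := by field_simp
    rw [this, rpow_one]
  have hb : 0 < c / 2 := by positivity
  have e2 : (2 * (c / 2)) ^ (-(2 / p)) = p / (4 * G) := by rw [mul_div_cancel₀ _ (by norm_num), hcm]
  have e4 : (4 * (c / 2)) ^ (-(2 / p)) = p / (4 * G) / exp 1 := by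
    have : 4 * (c / 2) = 2 * c := by ring
    rw [this, mul_rpow (by norm_num) hcp.le, hcm]
    have : (2:ℝ) ^ (-(2 / p)) = (exp 1)⁻¹ := by
      rw [rpow_def_of_pos (by norm_num), ← exp_neg, hpdef]
      congr 1; field_simp
    rw [this]; field_simp
  have hF := trL_FF hb hp
  rw [tru_I4 hb hp, ← hG, e4] at hF
  have hN := trL_normsq hb hp
  rw [(tru_I2 hb hp).2, (tru_ID hb hp).2, ← hG, e2] at hN
  refine ⟨trL (c/2) p hb hp, ?_, ?_⟩
  · rw [hF]; positivity
  · have : ‖trL (c/2) p hb hp‖ ^ 4 = (‖trL (c/2) p hb hp‖ ^ 2) ^ 2 := by ring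
    rw [this, hN, hF]
    field_simp
    ring

def eOne : E2 := EuclideanSpace.single 0 1
def eTwo : E2 := EuclideanSpace.single 1 1
lemma norm_eOne : ‖eOne‖ = 1 := by simp [eOne]

lemma norm_circ (r θ : ℝ) : ‖(r * cos θ) • eOne + (r * sin θ) • eTwo‖ = ‖r • eOne‖ := by
  rw [EuclideanSpace.norm_eq, norm_smul, norm_eOne]
  simp [eOne, eTwo, Fin.sum_univ_two]
  rw [← sqrt_sq_eq_abs]
  congr 1
  nlinarith [sin_sq_add_cos_sq θ]

def q1 (Q : E2 → ℝ) (r : ℝ) : ℝ := fderiv ℝ Q (r • eOne) eOne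
def qq (Q : E2 → ℝ) (r : ℝ) : ℝ := Q (r • eOne)

section
variable {Q : E2 → ℝ} 

lemma line_deriv (r : ℝ) (v : E2) : HasDerivAt (fun t : ℝ => t • v) v r := by
  simpa using (hasDerivAt_id r).smul_const v

lemma qq_deriv (hc : ContDiff ℝ 2 Q) (r : ℝ) : HasDerivAt (qq Q) (q1 Q r) r :=
  ((hc.differentiable (by norm_num)) (r • eOne)).hasFDerivAt.comp_hasDerivAt r (line_deriv r eOne)

lemma Dv_contDiff (hc : ContDiff ℝ 2 Q) (v : E2) : ContDiff ℝ 1 (fun y => fderiv ℝ Q y v) :=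
  (hc.fderiv_right (m := 1) (by norm_num)).clm_apply contDiff_const

lemma q1_deriv0 (hc : ContDiff ℝ 2 Q) (r : ℝ) :
    HasDerivAt (q1 Q) (fderiv ℝ (fun y => fderiv ℝ Q y eOne) (r • eOne) eOne) r := by
  have h := (((Dv_contDiff hc eOne).differentiable (by norm_num)) (r • eOne)).hasFDerivAt.comp_hasDerivAt r (line_deriv r eOne)
  exact h

lemma circ_deriv (r θ : ℝ) : HasDerivAt (fun θ => (r * cos θ) • eOne + (r * sin θ) • eTwo)
    ((r * (-sin θ)) • eOne + (r * cos θ) • eTwo) θ :=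
  (((hasDerivAt_cos θ).const_mul r).smul_const eOne).add (((hasDerivAt_sin θ).const_mul r).smul_const eTwo)

lemma ang (hc : ContDiff ℝ 2 Q) (hrad : ∀ x y : E2, ‖x‖ = ‖y‖ → Q x = Q y) {r : ℝ} (hr : 0 < r) :
    fderiv ℝ (fun y => fderiv ℝ Q y eTwo) (r • eOne) eTwo = q1 Q r / r := by
  set c : ℝ → E2 := fun θ => (r * cos θ) • eOne + (r * sin θ) • eTwo with hcdef
  have hc0 : c 0 = r • eOne := by simp [hcdef]
  have h1 : ∀ θ, r * (-sin θ) * fderiv ℝ Q (c θ) eOne + r * cos θ * fderiv ℝ Q (c θ) eTwo = 0 := by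
    intro θ
    have d1 := ((hc.differentiable (by norm_num)) (c θ)).hasFDerivAt.comp_hasDerivAt θ (circ_deriv r θ)
    have d2 : HasDerivAt (Q ∘ c) 0 θ := by
      have : Q ∘ c = fun _ => Q (r • eOne) := by
        ext t; exact hrad _ _ (norm_circ r t)
      rw [this]; exact hasDerivAt_const _ _
    have := d1.unique d2
    simpa using this
  have dc : ∀ v : E2, HasDerivAt (fun θ => fderiv ℝ Q (c θ) v)
      (fderiv ℝ (fun y => fderiv ℝ Q y v) (r • eOne) (r • eTwo)) 0 := by
    intro v
    have := (((Dv_contDiff hc v).differentiable (by norm_num)) (c 0)).hasFDerivAt.comp_hasDerivAt 0 (circ_deriv r 0)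
    simp only [sin_zero, cos_zero, neg_zero, mul_zero, zero_smul, zero_add, mul_one, hc0] at this
    exact this
  have D := (((hasDerivAt_sin 0).neg.const_mul r).mul (dc eOne)).add (((hasDerivAt_cos 0).const_mul r).mul (dc eTwo))
  have D2 : HasDerivAt (fun θ => r * (-sin θ) * fderiv ℝ Q (c θ) eOne + r * cos θ * fderiv ℝ Q (c θ) eTwo) 0 0 := by
    have : (fun θ => r * (-sin θ) * fderiv ℝ Q (c θ) eOne + r * cos θ * fderiv ℝ Q (c θ) eTwo) = fun _ => 0 := by
      ext θ; exact h1 θ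
    rw [this]; exact hasDerivAt_const _ _
  have := D.unique D2
  simp [hc0] at this
  unfold q1
  rw [eq_div_iff hr.ne']
  have hr2 : r * (fderiv ℝ (fun y => fderiv ℝ Q y eTwo) (r • eOne) eTwo * r - fderiv ℝ Q (r • eOne) eOne) = 0 := by
    linarith
  rcases mul_eq_zero.1 hr2 with h | h
  · exact absurd h hr.ne'
  · linarith

lemma Q_eq (hrad : ∀ x y : E2, ‖x‖ = ‖y‖ → Q x = Q y) (x : E2) : Q x = qq Q ‖x‖ := by
  refine hrad _ _ ?_
  rw [norm_smul, norm_eOne]; simp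

lemma q1_zero (hc : ContDiff ℝ 2 Q) (hrad : ∀ x y : E2, ‖x‖ = ‖y‖ → Q x = Q y) : q1 Q 0 = 0 := by
  have d1 := qq_deriv hc 0
  have d2 : HasDerivAt (fun r : ℝ => qq Q (-r)) (-(q1 Q 0)) 0 := by
    have h0 : HasDerivAt (qq Q) (q1 Q 0) (-(0:ℝ)) := by rw [neg_zero]; exact d1
    have := h0.comp (0:ℝ) (hasDerivAt_neg (0:ℝ))
    refine this.congr_deriv ?_
    simp
  have e : (fun r : ℝ => qq Q (-r)) = qq Q := by
    ext r; refine hrad _ _ ?_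
    rw [neg_smul, norm_neg]
  rw [e] at d2
  have := d1.unique d2
  linarith

lemma q1_cont (hc : ContDiff ℝ 2 Q) : Continuous (q1 Q) :=
  continuous_iff_continuousAt.2 fun r => (q1_deriv0 hc r).continuousAt

lemma qq_cont (hc : ContDiff ℝ 2 Q) : Continuous (qq Q) :=
  continuous_iff_continuousAt.2 fun r => (qq_deriv hc r).continuousAt

lemma q1_le_grad (hc : ContDiff ℝ 2 Q) (hrad : ∀ x y : E2, ‖x‖ = ‖y‖ → Q x = Q y) (x : E2) :
    q1 Q ‖x‖ ^ 2 ≤ gradSq Q x := by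
  by_cases hx : x = 0
  · subst hx
    rw [norm_zero, q1_zero hc hrad]
    simp [gradSq]
  · have hn : 0 < ‖x‖ := norm_pos_iff.2 hx
    set v : E2 := ‖x‖⁻¹ • x with hv
    have hvn : ‖v‖ = 1 := by rw [hv, norm_smul, norm_inv, norm_norm, inv_mul_cancel₀ hn.ne']
    have hxv : ‖x‖ • v = x := by rw [hv, smul_smul, mul_inv_cancel₀ hn.ne', one_smul]
    have d1 := ((hc.differentiable (by norm_num)) (‖x‖ • v)).hasFDerivAt.comp_hasDerivAt ‖x‖ (line_deriv ‖x‖ v)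
    have e : (Q ∘ fun t : ℝ => t • v) = qq Q := by
      ext t; refine hrad _ _ ?_
      rw [norm_smul t v, norm_smul t eOne, hvn, norm_eOne]
    rw [e] at d1
    have h2 := d1.unique (qq_deriv hc ‖x‖)
    rw [hxv] at h2
    rw [← h2]
    unfold gradSq
    have h3 := (fderiv ℝ Q x).le_opNorm v
    rw [hvn, mul_one, norm_eq_abs] at h3
    rw [← sq_abs]
    gcongr

lemma rad_int (f : ℝ → ℝ) : Integrable (fun x : E2 => f ‖x‖) ↔ IntegrableOn (fun r => r * f r) (Ioi 0) := by
  have := integrable_fun_norm_addHaar (volume : Measure E2) (f := f)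
  simpa using this

lemma rad_integral (f : ℝ → ℝ) : ∫ x : E2, f ‖x‖ = 2 * π * ∫ r in Ioi (0:ℝ), r * f r := by
  have := integral_fun_norm_addHaar (volume : Measure E2) f
  rw [this]
  have hv : (volume : Measure E2).real (Metric.ball 0 1) = π := by
    rw [Measure.real, EuclideanSpace.volume_ball_fin_two]
    simp [pi_pos.le]
  rw [hv]
  simp
  ring

theorem radSol_of_ground (hQ : IsGroundState Q) : RadSol (qq Q) (q1 Q) (Q 0) ∧
    IntegrableOn (fun r => r * qq Q r ^ 2) (Ioi 0) ∧ IntegrableOn (fun r => r * qq Q r ^ 4) (Ioi 0) ∧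
    ∫ x : E2, Q x ^ 2 = 2 * π * ∫ r in Ioi (0:ℝ), r * qq Q r ^ 2 := by
  obtain ⟨hc, hpos, hrad, ⟨-, i2, ig, i4⟩, heq⟩ := hQ
  have e2 : (fun x => Q x ^ 2) = fun x => (fun r => qq Q r ^ 2) ‖x‖ := by
    ext x; simp only; rw [Q_eq hrad x]
  have e4 : (fun x => Q x ^ 4) = fun x => (fun r => qq Q r ^ 4) ‖x‖ := by
    ext x; simp only; rw [Q_eq hrad x]
  have j2 : IntegrableOn (fun r => r * qq Q r ^ 2) (Ioi 0) := (rad_int fun r => qq Q r ^ 2).1 (e2 ▸ i2)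
  have j4 : IntegrableOn (fun r => r * qq Q r ^ 4) (Ioi 0) := (rad_int fun r => qq Q r ^ 4).1 (e4 ▸ i4)
  have j1 : IntegrableOn (fun r => r * q1 Q r ^ 2) (Ioi 0) := by
    refine (rad_int fun r => q1 Q r ^ 2).1 ?_
    refine Integrable.mono' ig (((q1_cont hc).comp continuous_norm).pow 2).aestronglyMeasurable (Eventually.of_forall fun x => ?_)
    rw [Real.norm_of_nonneg (sq_nonneg _)]
    exact q1_le_grad hc hrad x
  refine ⟨⟨fun r _ => hpos _, fun r _ => qq_deriv hc r, fun r hr => ?_, hpos 0, ?_, ?_, ?_⟩, j2, j4, ?_⟩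
  · refine (q1_deriv0 hc r).congr_deriv ?_
    have h1 := heq (r • eOne)
    have h2 := ang hc hrad hr
    simp only [lap, Fin.sum_univ_two] at h1
    change -(fderiv ℝ (fun y => fderiv ℝ Q y eOne) (r • eOne) eOne + fderiv ℝ (fun y => fderiv ℝ Q y eTwo) (r • eOne) eTwo) + qq Q r - qq Q r ^ 3 = 0 at h1
    rw [h2] at h1
    rw [neg_div]; linarith
  · have := (qq_cont hc).tendsto 0
    have e : qq Q 0 = Q 0 := by simp [qq]
    rw [e] at this
    exact this.mono_left nhdsWithin_le_nhds
  · have := (q1_cont hc).tendsto 0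
    rw [q1_zero hc hrad] at this
    exact this.mono_left nhdsWithin_le_nhds
  · refine ((j2.add j1).add j4).congr (Eventually.of_forall fun r => ?_)
    simp only [Pi.add_apply]; ring
  · rw [e2]; exact rad_integral (fun r => qq Q r ^ 2)
end

theorem ground_bound (Q : E2 → ℝ) (hQ : IsGroundState Q) :
    (∫ x : E2, Q x ^ 2) ≤ 2 * π * Real.exp 1 * Real.log 2 := by
  obtain ⟨h0, hF, hN⟩ := trial
  obtain ⟨S, hS, hle, v, v1, α, hv, hv4⟩ := exists_radSol h0 hF
  obtain ⟨hq, j2, j4, hinteg⟩ := radSol_of_ground hQ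
  have h4 : ∫ r in Ioi (0:ℝ), r * qq Q r ^ 4 = 1 / S := by
    rw [← hv4]
    refine setIntegral_congr_fun measurableSet_Ioi fun r hr => ?_
    rw [hq.unique hv hr]
  rw [hinteg, hq.pohozaev j2 j4, h4]
  rw [hN] at hle
  have h1 : 1 ≤ S * (2 * log 2 * exp 1) := by
    by_contra! hcon
    nlinarith
  have h2 : 1 / S ≤ 2 * log 2 * exp 1 := by
    rw [div_le_iff₀ hS]; linarith
  nlinarith [pi_pos]

end Aux

theorem stmt3 (Q : E2 → ℝ) (hQ : IsGroundState Q) :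
    (∫ x : E2, Q x ^ 2) ≤ 2 * π * Real.exp 1 * Real.log 2 := by
  exact ground_bound Q hQ
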